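/- An arrangement 𝓗 of topoplanes in ℝⁿ is affine if and only if for every pair of distinct intersecting topoplanes H₁, H₂ ∈ 𝓗, every connected component R of ℝⁿ ∖ (H₁ ∪ H₂) has closure meeting both H₁ ∖ H₂ and H₂ ∖ H₁. -/

import Mathlib

open Set

/-- The `i`-th coordinate hyperplane in `ℝⁿ` (by convention the whole space if `i ≥ n`). -/
def coordHyp (n i : ℕ) : Set (Fin n → ℝ) := {x | ∀ h : i < n, x ⟨i, h⟩ = 0}

/-- `H` is a topological hyperplane (topoplane) in `ℝⁿ`: some self-homeomorphism of `ℝⁿ`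
carries `H` onto the coordinate hyperplane `{x | x₁ = 0}`. -/
def IsTopoplane {n : ℕ} (H : Set (Fin n → ℝ)) : Prop :=
  ∃ e : (Fin n → ℝ) ≃ₜ (Fin n → ℝ), e '' H = coordHyp n 0

/-- `Z` is a relative topoplane in `Y ⊆ ℝⁿ`: `Z ⊆ Y` and some homeomorphism of `Y`
(with the subspace topology) onto some `ℝᵈ`, `d ≥ 1`, carries `Z` onto `{x | x₁ = 0}`. -/
def IsRelTopoplane {n : ℕ} (Y Z : Set (Fin n → ℝ)) : Prop :=
  Z ⊆ Y ∧ ∃ d : ℕ, 1 ≤ d ∧ ∃ φ : Y ≃ₜ (Fin d → ℝ),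
    φ '' {y : Y | (y : Fin n → ℝ) ∈ Z} = coordHyp d 0

/-- `Y` is a flat of the family `𝓗`: a nonempty intersection of a subfamily of `𝓗`
(the empty intersection being all of `ℝⁿ`). -/
def IsFlat {n : ℕ} (𝓗 : Set (Set (Fin n → ℝ))) (Y : Set (Fin n → ℝ)) : Prop :=
  (∃ 𝓢 ⊆ 𝓗, Y = ⋂₀ 𝓢) ∧ Y.Nonempty

/-- `𝓗` is an arrangement of topoplanes in `ℝⁿ`: a finite set of topoplanes such that for
every `H ∈ 𝓗` and every flat `Y`, either `Y ⊆ H`, or `H ∩ Y = ∅`, or `H ∩ Y` is a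
relative topoplane in `Y`. -/
def IsArrangement {n : ℕ} (𝓗 : Set (Set (Fin n → ℝ))) : Prop :=
  𝓗.Finite ∧ (∀ H ∈ 𝓗, IsTopoplane H) ∧
    ∀ H ∈ 𝓗, ∀ Y : Set (Fin n → ℝ), IsFlat 𝓗 Y →
      Y ⊆ H ∨ H ∩ Y = ∅ ∨ IsRelTopoplane Y (H ∩ Y)

/-- `Y` has dimension `d`: it is homeomorphic, in the subspace topology, to `ℝᵈ`. -/
def HasDim {n : ℕ} (Y : Set (Fin n → ℝ)) (d : ℕ) : Prop :=
  Nonempty (Y ≃ₜ (Fin d → ℝ))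

/-- Topoplanes `H₁`, `H₂` cross: some self-homeomorphism of `ℝⁿ` carries them
simultaneously onto the coordinate hyperplanes `{x | x₁ = 0}` and `{x | x₂ = 0}`. -/
def Crosses {n : ℕ} (H₁ H₂ : Set (Fin n → ℝ)) : Prop :=
  ∃ e : (Fin n → ℝ) ≃ₜ (Fin n → ℝ), e '' H₁ = coordHyp n 0 ∧ e '' H₂ = coordHyp n 1

/-- The pairwise condition for an arrangement to be affine: any two distinct members
are disjoint or cross. -/
def PairwiseAffine {n : ℕ} (𝓗 : Set (Set (Fin n → ℝ))) : Prop :=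
  ∀ H₁ ∈ 𝓗, ∀ H₂ ∈ 𝓗, H₁ ≠ H₂ → H₁ ∩ H₂ = ∅ ∨ Crosses H₁ H₂

section DeterminantIntegral

open MeasureTheory

variable {E : Type*} [NormedAddCommGroup E] [InnerProductSpace ℝ E] [FiniteDimensional ℝ E]

theorem exists_polynomial_eval_eq_det_one_add_smul (A : E →L[ℝ] E) :
    ∃ p : Polynomial ℝ, p.natDegree ≤ Module.finrank ℝ E ∧
      ∀ t : ℝ, p.eval t = (1 + t • A).det := by
  classical
  let b := Module.finBasis ℝ E
  let B := LinearMap.toMatrix b b (A : E →ₗ[ℝ] E)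
  refine ⟨((Polynomial.X : Polynomial ℝ) • B.map Polynomial.C +
    (1 : Matrix _ _ ℝ).map Polynomial.C).det, ?_, fun t => ?_⟩
  · simpa using Polynomial.natDegree_det_X_add_C_le B 1
  · have h : (1 + t • A : E →L[ℝ] E).det =
        (LinearMap.toMatrix b b ((1 + t • A : E →L[ℝ] E) : E →ₗ[ℝ] E)).det :=
      (LinearMap.det_toMatrix b _).symm
    have h2 : LinearMap.toMatrix b b ((1 + t • A : E →L[ℝ] E) : E →ₗ[ℝ] E) = t • B + 1 := by
      have : ((1 + t • A : E →L[ℝ] E) : E →ₗ[ℝ] E) = LinearMap.id + t • (A : E →ₗ[ℝ] E) := rfl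
      rw [this, map_add, map_smul, LinearMap.toMatrix_id, add_comm]
    rw [h, h2, ← Polynomial.coe_evalRingHom, RingHom.map_det]
    congr 1
    ext i j
    simp [Matrix.one_apply]
    split_ifs <;> simp [mul_comm]

theorem det_one_add_pos_of_norm_lt_one {A : E →L[ℝ] E} (hA : ‖A‖ < 1) : 0 < (1 + A).det := by
  have hinv : ∀ s ∈ Icc (0 : ℝ) 1, (1 + s • A).det ≠ 0 := by
    intro s hs h0
    have hs' : ‖s • A‖ < 1 := by
      rw [norm_smul, Real.norm_eq_abs, abs_of_nonneg hs.1]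
      nlinarith [norm_nonneg A, hs.2]
    have hu : IsUnit (1 + s • A) := by
      have := isUnit_one_sub_of_norm_lt_one (x := -(s • A)) (by rwa [norm_neg])
      simpa using this
    have : IsUnit ((1 + s • A : E →L[ℝ] E) : E →ₗ[ℝ] E) := by
      obtain ⟨u, hu⟩ := hu
      rw [← hu]
      exact (u.isUnit).map ContinuousLinearMap.toLinearMapRingHom
    exact (LinearMap.isUnit_iff_isUnit_det _ |>.1 this).ne_zero h0
  have hc : Continuous fun s : ℝ => (1 + s • A).det :=
    ContinuousLinearMap.continuous_det.comp (by fun_prop)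
  by_contra hneg
  have h0 : (1 + (0 : ℝ) • A).det = 1 := by
    simp [ContinuousLinearMap.det]
  have h1 : (1 + (1 : ℝ) • A).det ≤ 0 := by simpa using not_lt.1 hneg
  obtain ⟨s, hs, hs0⟩ := intermediate_value_Icc' (zero_le_one) hc.continuousOn
    (show (0 : ℝ) ∈ Icc _ _ from ⟨h1, by rw [h0]; norm_num⟩)
  exact hinv s hs hs0

variable [MeasurableSpace E] [BorelSpace E]

/-- A small straight-line deformation of the identity towards a map of the ball fixing the sphere
is a diffeomorphism of the ball. -/
theorem exists_forall_integral_det_eq_volume_ball {R : E → E} (hR : ContDiff ℝ 1 R)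
    (hsph : ∀ x, ‖x‖ = 2 → R x = x) (hball : ∀ x, ‖x‖ ≤ 2 → ‖R x‖ ≤ 2) :
    ∃ δ > 0, ∀ t ∈ Ioo (0 : ℝ) δ,
      ∫ x in Metric.ball (0 : E) 2, (1 + t • (fderiv ℝ R x - 1)).det =
        (volume : Measure E).real (Metric.ball 0 2) := by
  set v : E → E := fun x => R x - x with hv
  have hvd : ∀ x, HasFDerivAt v (fderiv ℝ R x - 1) x := fun x =>
    (hR.differentiable one_ne_zero x).hasFDerivAt.sub (hasFDerivAt_id x)
  have hcont : Continuous fun x => fderiv ℝ R x - 1 :=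
    (hR.continuous_fderiv one_ne_zero).sub continuous_const
  obtain ⟨K, hK⟩ := (isCompact_closedBall (0 : E) 2).exists_bound_of_continuousOn hcont.continuousOn
  have hlip : ∀ x ∈ Metric.closedBall (0 : E) 2, ∀ y ∈ Metric.closedBall (0 : E) 2,
      ‖v y - v x‖ ≤ K * ‖y - x‖ := fun x hx y hy =>
    (convex_closedBall (0 : E) 2).norm_image_sub_le_of_norm_hasFDerivWithin_le
      (fun z _ => (hvd z).hasFDerivWithinAt) hK hx hy
  refine ⟨1 / (|K| + 1), by positivity, fun t ht => ?_⟩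
  have ht1 : t * (|K| + 1) < 1 := (lt_div_iff₀ (by positivity)).1 ht.2
  have ht2 : t < 1 := by nlinarith [abs_nonneg K, ht.1]
  have htK : t * K < 1 := by nlinarith [le_abs_self K, ht.1]
  set F : E → E := fun x => x + t • v x with hF
  have hFd : ∀ x, HasFDerivAt F (1 + t • (fderiv ℝ R x - 1)) x := fun x =>
    (hasFDerivAt_id x).add ((hvd x).const_smul t)
  have hpos : ∀ x ∈ Metric.ball (0 : E) 2, 0 < (1 + t • (fderiv ℝ R x - 1)).det := by
    intro x hx
    refine det_one_add_pos_of_norm_lt_one ?_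
    rw [norm_smul, Real.norm_eq_abs, abs_of_pos ht.1]
    nlinarith [hK x (Metric.ball_subset_closedBall hx), ht.1]
  have hinj : InjOn F (Metric.closedBall 0 2) := by
    intro x hx y hy hxy
    by_contra hne
    have h1 : y - x = - (t • (v y - v x)) := by
      simp only [hF] at hxy
      rw [smul_sub]
      linear_combination (norm := module) (-1 : ℝ) • hxy
    have h2 : ‖y - x‖ ≤ t * (K * ‖y - x‖) := by
      conv_lhs => rw [h1]
      rw [norm_neg, norm_smul, Real.norm_eq_abs, abs_of_pos ht.1]
      exact mul_le_mul_of_nonneg_left (hlip x hx y hy) ht.1.le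
    have h3 : 0 < ‖y - x‖ := norm_pos_iff.2 (sub_ne_zero.2 (Ne.symm hne))
    nlinarith
  have hFcont : Continuous F := by
    have := hR.continuous
    fun_prop
  have hmaps : F '' Metric.ball 0 2 ⊆ Metric.ball 0 2 := by
    rintro _ ⟨x, hx, rfl⟩
    rw [mem_ball_zero_iff] at hx ⊢
    have : F x = (1 - t) • x + t • R x := by simp only [hF, hv]; module
    rw [this]
    calc _ ≤ ‖(1 - t) • x‖ + ‖t • R x‖ := norm_add_le _ _
      _ = (1 - t) * ‖x‖ + t * ‖R x‖ := by
        rw [norm_smul, norm_smul, Real.norm_eq_abs, Real.norm_eq_abs, abs_of_pos ht.1,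
          abs_of_pos (by linarith)]
      _ < 2 := by nlinarith [hball x hx.le, ht.1]
  have hFC : ContDiff ℝ 1 F := contDiff_id.add ((hR.sub contDiff_id).const_smul t)
  have hopen : IsOpen (F '' Metric.ball 0 2) := by
    rw [isOpen_iff_mem_nhds]
    rintro _ ⟨x, hx, rfl⟩
    have hs : HasStrictFDerivAt F (1 + t • (fderiv ℝ R x - 1)) x :=
      (hFC.contDiffAt.hasStrictFDerivAt' (hFd x) one_ne_zero)
    have hr : ((1 + t • (fderiv ℝ R x - 1) : E →L[ℝ] E) : E →ₗ[ℝ] E).range = ⊤ := by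
      rw [LinearMap.range_eq_top]
      have := LinearMap.isUnit_iff_isUnit_det
        ((1 + t • (fderiv ℝ R x - 1) : E →L[ℝ] E) : E →ₗ[ℝ] E) |>.2 (hpos x hx).ne'.isUnit
      exact ((Module.End.isUnit_iff _).1 this).2
    rw [← hs.map_nhds_eq_of_surj hr]
    exact Filter.image_mem_map (Metric.isOpen_ball.mem_nhds hx)
  have himage : F '' Metric.ball 0 2 = Metric.ball 0 2 := by
    refine hmaps.antisymm (Metric.isPreconnected_ball.subset_of_closure_inter_subset hopen ?_ ?_)
    · refine ⟨F 0, hmaps (mem_image_of_mem F ?_), mem_image_of_mem F ?_⟩ <;> simp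
    · rintro y ⟨hy, hyb⟩
      have hcl : IsClosed (F '' Metric.closedBall 0 2) :=
        ((isCompact_closedBall (0 : E) 2).image hFcont).isClosed
      obtain ⟨x, hx, rfl⟩ := closure_minimal (image_mono Metric.ball_subset_closedBall) hcl hy
      refine mem_image_of_mem F ?_
      rw [mem_closedBall_zero_iff] at hx
      rw [mem_ball_zero_iff] at hyb ⊢
      refine lt_of_le_of_ne hx fun h => ?_
      have : F x = x := by simp [hF, hv, hsph x h]
      rw [this] at hyb
      linarith
  have key := integral_image_eq_integral_abs_det_fderiv_smul (volume : Measure E)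
    (measurableSet_ball (x := (0 : E)) (ε := 2)) (fun x _ => (hFd x).hasFDerivWithinAt)
    (hinj.mono Metric.ball_subset_closedBall) (fun _ => (1 : ℝ))
  rw [himage] at key
  simp only [smul_eq_mul, mul_one, integral_const] at key
  rw [measureReal_restrict_apply_univ] at key
  rw [key]
  refine setIntegral_congr_fun measurableSet_ball fun x hx => ?_
  exact (abs_of_pos (hpos x hx)).symm

theorem integral_det_fderiv_eq_volume_ball {R : E → E} (hR : ContDiff ℝ 1 R)
    (hsph : ∀ x, ‖x‖ = 2 → R x = x) (hball : ∀ x, ‖x‖ ≤ 2 → ‖R x‖ ≤ 2) :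
    ∫ x in Metric.ball (0 : E) 2, (fderiv ℝ R x).det =
        (volume : Measure E).real (Metric.ball 0 2) := by
  obtain ⟨δ, hδ, h⟩ := exists_forall_integral_det_eq_volume_ball hR hsph hball
  set m := Module.finrank ℝ E
  let s := Finset.range (m + 1)
  let node : ℕ → ℝ := fun j => δ * ((j + 1) / (m + 2))
  have hnode : ∀ j ∈ s, node j ∈ Ioo (0 : ℝ) δ := by
    intro j hj
    have hj' : (j : ℝ) < m + 1 := by exact_mod_cast Finset.mem_range.1 hj
    have hlt : ((j : ℝ) + 1) / (m + 2) < 1 := by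
      rw [div_lt_one (by positivity)]
      linarith
    exact ⟨by positivity, by simp only [node]; nlinarith⟩
  have hinj : Set.InjOn node s := by
    intro i _ j _ hij
    have h1 : ((i : ℝ) + 1) / (m + 2) = (j + 1) / (m + 2) := mul_left_cancel₀ hδ.ne' hij
    have hm : (m + 2 : ℝ) ≠ 0 := by positivity
    rw [div_left_inj' hm] at h1
    exact_mod_cast (add_left_injective _ h1 : (i : ℝ) = j)
  let w : ℕ → ℝ := fun j => (Lagrange.basis s node j).eval 1
  have hinterp : ∀ p : Polynomial ℝ, p.natDegree ≤ m →
      p.eval 1 = ∑ j ∈ s, w j * p.eval (node j) := by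
    intro p hp
    have hd : p.degree < s.card := by
      rw [Finset.card_range]
      exact lt_of_le_of_lt (Polynomial.degree_le_of_natDegree_le hp)
        (by exact_mod_cast Nat.lt_succ_self m)
    conv_lhs => rw [Lagrange.eq_interpolate hinj hd, Lagrange.interpolate_apply]
    rw [Polynomial.eval_finsetSum]
    refine Finset.sum_congr rfl fun j _ => ?_
    simp [w, mul_comm]
  have hw : ∑ j ∈ s, w j = 1 := by
    have := hinterp 1 (by simp)
    simpa using this.symm
  have hdet : ∀ x, (fderiv ℝ R x).det =
      ∑ j ∈ s, w j * (1 + node j • (fderiv ℝ R x - 1)).det := by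
    intro x
    obtain ⟨p, hp, hpe⟩ := exists_polynomial_eval_eq_det_one_add_smul (fderiv ℝ R x - 1)
    have := hinterp p hp
    simp only [hpe] at this
    simpa using this
  have hint : ∀ j, IntegrableOn (fun x => (1 + node j • (fderiv ℝ R x - 1)).det)
      (Metric.ball (0 : E) 2) volume := by
    intro j
    have hc : Continuous fun x => (1 + node j • (fderiv ℝ R x - 1)).det := by
      have := hR.continuous_fderiv one_ne_zero
      exact ContinuousLinearMap.continuous_det.comp (by fun_prop)
    exact (hc.continuousOn.integrableOn_compact (isCompact_closedBall (0 : E) 2)).mono_set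
      Metric.ball_subset_closedBall
  simp only [hdet]
  rw [integral_finsetSum _ fun j _ => (hint j).const_mul (w j)]
  simp only [integral_const_mul]
  rw [Finset.sum_congr rfl fun j hj => by rw [h _ (hnode j hj)], ← Finset.sum_mul, hw, one_mul]

end DeterminantIntegral

section InvarianceOfDimension

open MeasureTheory

variable {E : Type*} [NormedAddCommGroup E] [InnerProductSpace ℝ E] [FiniteDimensional ℝ E]

theorem det_fderiv_eq_zero_of_norm_eq {R : E → E} (hR : Differentiable ℝ R) {r : ℝ} (hr : 0 < r)
    (hnorm : ∀ x, ‖R x‖ = r) (x : E) : (fderiv ℝ R x).det = 0 := by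
  have h1 := ((hR x).hasFDerivAt).norm_sq
  have h2 : HasFDerivAt (fun x => ‖R x‖ ^ 2) (0 : E →L[ℝ] ℝ) x := by
    simp only [hnorm]
    exact hasFDerivAt_const _ _
  have h3 := h1.unique h2
  by_contra hdet
  have hs : Function.Surjective (fderiv ℝ R x) :=
    ((Module.End.isUnit_iff _).1 ((LinearMap.isUnit_iff_isUnit_det
      ((fderiv ℝ R x : E →L[ℝ] E) : E →ₗ[ℝ] E)).2 (isUnit_iff_ne_zero.2 hdet))).2
  obtain ⟨v, hv⟩ := hs (R x)
  have h4 := congrArg (fun L : E →L[ℝ] ℝ => L v) h3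
  simp [hv, hnorm] at h4
  exact hr.ne h4.symm

/-- No-retraction theorem, in the form: a continuous map which is the identity outside of the unit
ball has a zero. -/
theorem exists_eq_zero_of_eq_self_of_one_le_norm {g : E → E} (hg : Continuous g)
    (hid : ∀ x, 1 ≤ ‖x‖ → g x = x) : ∃ x, g x = 0 := by
  by_contra! hne
  borelize E
  obtain ⟨h, hh, hdist, heq, -⟩ := hg.exists_contDiff_approx_and_eqOn 1 (ε := fun x => ‖g x‖)
    (by fun_prop) (fun x => norm_pos_iff.2 (hne x)) (S := {x | 2 ≤ ‖x‖}) (U := {x | 1 < ‖x‖})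
    (isClosed_le continuous_const continuous_norm)
    ((isOpen_lt continuous_const continuous_norm).mem_nhdsSet.2
      fun x (hx : 2 ≤ ‖x‖) => show 1 < ‖x‖ by linarith)
    ((contDiffOn_id (E := E)).congr fun x (hx : 1 < ‖x‖) => hid x hx.le)
  have hh0 : ∀ x, h x ≠ 0 := by
    intro x h0
    have := hdist x
    rw [h0, dist_zero_left] at this
    exact lt_irrefl _ this
  set R : E → E := fun x => (2 * ‖h x‖⁻¹) • h x with hR
  have hRd : ContDiff ℝ 1 R :=
    (contDiff_const.mul ((hh.norm ℝ hh0).inv fun x => norm_ne_zero_iff.2 (hh0 x))).smul hh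
  have hnorm : ∀ x, ‖R x‖ = 2 := by
    intro x
    have : ‖h x‖ ≠ 0 := norm_ne_zero_iff.2 (hh0 x)
    simp only [hR, norm_smul, norm_mul, norm_inv, norm_norm]
    field_simp
    simp
  have hsph : ∀ x, ‖x‖ = 2 → R x = x := by
    intro x hx
    have : h x = x := (heq (show 2 ≤ ‖x‖ from hx.ge)).trans (hid x (by linarith))
    simp [hR, this, hx]
  have key := integral_det_fderiv_eq_volume_ball hRd hsph fun x _ => (hnorm x).le
  simp only [det_fderiv_eq_zero_of_norm_eq (hRd.differentiable one_ne_zero) two_pos hnorm,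
    integral_zero] at key
  have : 0 < (volume : Measure E).real (Metric.ball 0 2) :=
    ENNReal.toReal_pos (Metric.measure_ball_pos _ _ two_pos).ne' measure_ball_lt_top.ne
  exact this.ne key

theorem le_of_homeomorph_pi {k d : ℕ} (ψ : (Fin k → ℝ) ≃ₜ (Fin d → ℝ)) : k ≤ d := by
  by_contra! hdk
  let E := EuclideanSpace ℝ (Fin k)
  let u : E ≃L[ℝ] (Fin k → ℝ) := EuclideanSpace.equiv (Fin k) ℝ
  let π : (Fin k → ℝ) →ₗ[ℝ] (Fin d → ℝ) := LinearMap.funLeft ℝ ℝ (Fin.castLE hdk.le)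
  obtain ⟨i, hi⟩ := π.exists_rightInverse_of_surjective (LinearMap.range_eq_top.2
    (LinearMap.funLeft_surjective_of_injective ℝ ℝ _ (Fin.castLE_injective hdk.le)))
  have hi' : ∀ y, π (i y) = y := fun y => congrArg (fun L : _ →ₗ[ℝ] _ => L y) hi
  have hic : Continuous i := i.continuous_of_finiteDimensional
  have hπc : Continuous π := π.continuous_of_finiteDimensional
  let j : (Fin d → ℝ) →ₗ[ℝ] E := (u.symm : (Fin k → ℝ) →ₗ[ℝ] E) ∘ₗ i
  have hjc : Continuous j := j.continuous_of_finiteDimensional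
  let f : E → E := fun x => j (ψ (u x))
  let κ : E → E := fun x => u.symm (ψ.symm (π (u x)))
  have hκf : ∀ x, κ (f x) = x := by
    intro x
    have : u (j (ψ (u x))) = i (ψ (u x)) := u.apply_symm_apply _
    simp only [κ, f, this, hi', ψ.symm_apply_apply, u.symm_apply_apply]
  have hfc : Continuous f := hjc.comp (ψ.continuous.comp u.continuous)
  have hκc : Continuous κ :=
    u.symm.continuous.comp (ψ.symm.continuous.comp (hπc.comp u.continuous))
  obtain ⟨κ₁, hκ₁, hdist, -⟩ := hκc.exists_contDiff_approx 1 (ε := fun _ => 1 / 4)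
    continuous_const (fun _ => by norm_num)
  have hnull : (volume : Measure E) (κ₁ '' (LinearMap.range j : Set E)) = 0 := by
    refine addHaar_image_eq_zero_of_differentiableOn_of_addHaar_eq_zero _
      (hκ₁.differentiable (by norm_num)).differentiableOn ?_
    refine Measure.addHaar_submodule _ _ fun htop => ?_
    have h1 := LinearMap.finrank_range_le j
    rw [htop, finrank_top] at h1
    simp [E] at h1
    omega
  obtain ⟨q, hqb, hq⟩ : ∃ q ∈ Metric.ball (0 : E) (1 / 4), q ∉ κ₁ '' (LinearMap.range j : Set E) := by
    by_contra! hcon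
    have h1 : (volume : Measure E) (Metric.ball (0 : E) (1 / 4)) ≤ 0 := hnull ▸ measure_mono hcon
    exact absurd h1 (not_le.2 (Metric.measure_ball_pos _ _ (by norm_num)))
  rw [mem_ball_zero_iff] at hqb
  let φ : E → E := fun x => κ₁ (f x)
  have hφ : ∀ x, ‖φ x - x‖ < 1 / 4 := by
    intro x
    have := hdist (f x)
    rwa [hκf, dist_eq_norm] at this
  let χ : E → ℝ := fun x => max 0 (min 1 (2 - 2 * ‖x‖))
  have hφc : Continuous φ := hκ₁.continuous.comp hfc
  obtain ⟨x, hx⟩ := exists_eq_zero_of_eq_self_of_one_le_norm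
    (g := fun x => x + χ x • (φ x - q - x)) (by fun_prop) (by
      intro x hx
      have : χ x = 0 := max_eq_left ((min_le_right _ _).trans (by linarith))
      simp [this])
  have hχ : 0 ≤ χ x ∧ χ x ≤ 1 := ⟨le_max_left _ _, max_le zero_le_one (min_le_left _ _)⟩
  rcases le_or_gt ‖x‖ (1 / 2) with h | h
  · have h1 : χ x = 1 := by
      have : min 1 (2 - 2 * ‖x‖) = 1 := min_eq_left (by linarith)
      simp [χ, this]
    have h2 : φ x = q := by
      rw [h1] at hx
      linear_combination (norm := module) hx
    exact hq (h2 ▸ mem_image_of_mem κ₁ ⟨_, rfl⟩)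
  · have h1 : ‖χ x • (φ x - q - x)‖ ≤ 1 / 2 := by
      rw [norm_smul, Real.norm_eq_abs, abs_of_nonneg hχ.1]
      have h2 : ‖φ x - q - x‖ ≤ ‖φ x - x‖ + ‖q‖ := by
        rw [show φ x - q - x = (φ x - x) - q by abel]
        exact norm_sub_le _ _
      nlinarith [hφ x, norm_nonneg (φ x - q - x)]
    have h2 : x = -(χ x • (φ x - q - x)) := eq_neg_of_add_eq_zero_left hx
    have h3 : ‖x‖ = ‖χ x • (φ x - q - x)‖ := by
      conv_lhs => rw [h2]
      rw [norm_neg]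
    linarith

/-- Invariance of dimension. -/
theorem eq_of_homeomorph_pi {k d : ℕ} (ψ : (Fin k → ℝ) ≃ₜ (Fin d → ℝ)) : k = d :=
  (le_of_homeomorph_pi ψ).antisymm (le_of_homeomorph_pi ψ.symm)

end InvarianceOfDimension

section Squash

open Filter Topology

/-- An increasing bijection of `ℝ` onto `(0, ∞)` which is the identity on `[δ, ∞)`. -/
noncomputable def squash (δ t : ℝ) : ℝ := max t δ * (δ / (2 * δ - min t δ))

/-- The inverse of `squash δ`. -/
noncomputable def unsquash (δ s : ℝ) : ℝ := max s δ + δ - δ ^ 2 / min s δ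

theorem squash_of_le {δ t : ℝ} (hδ : 0 < δ) (h : δ ≤ t) : squash δ t = t := by
  rw [squash, max_eq_left h, min_eq_right h]
  field_simp
  ring

theorem squash_of_ge {δ t : ℝ} (h : t ≤ δ) : squash δ t = δ ^ 2 / (2 * δ - t) := by
  rw [squash, max_eq_right h, min_eq_left h]
  ring

theorem unsquash_of_le {δ t : ℝ} (h : δ ≤ t) : unsquash δ t = t := by
  rw [unsquash, max_eq_left h, min_eq_right h]
  field_simp
  ring

theorem unsquash_of_ge {δ t : ℝ} (h : t ≤ δ) : unsquash δ t = 2 * δ - δ ^ 2 / t := by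
  rw [unsquash, max_eq_right h, min_eq_left h]
  ring

theorem squash_pos {δ : ℝ} (hδ : 0 < δ) (t : ℝ) : 0 < squash δ t := by
  have h1 : min t δ ≤ δ := min_le_right _ _
  have h2 : δ ≤ max t δ := le_max_right _ _
  have h3 : 0 < 2 * δ - min t δ := by linarith
  have h4 : 0 < max t δ := by linarith
  unfold squash
  positivity

theorem unsquash_squash {δ : ℝ} (hδ : 0 < δ) (t : ℝ) : unsquash δ (squash δ t) = t := by
  rcases le_total δ t with h | h
  · rw [squash_of_le hδ h, unsquash_of_le h]
  · have h3 : 0 < 2 * δ - t := by linarith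
    rw [squash_of_ge h, unsquash_of_ge]
    · field_simp
      ring
    · rw [div_le_iff₀ h3]
      nlinarith

theorem squash_unsquash {δ s : ℝ} (hδ : 0 < δ) (hs : 0 < s) : squash δ (unsquash δ s) = s := by
  rcases le_total δ s with h | h
  · rw [unsquash_of_le h, squash_of_le hδ h]
  · rw [unsquash_of_ge h, squash_of_ge]
    · field_simp
      rw [sub_sub_cancel, div_self hδ.ne']
    · have : δ ≤ δ ^ 2 / s := by
        rw [le_div_iff₀ hs]
        nlinarith
      linarith

theorem continuousAt_squash {δ : ℝ} (hδ : 0 < δ) (t : ℝ) :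
    ContinuousAt (fun p : ℝ × ℝ => squash p.1 p.2) (δ, t) := by
  have h3 : 2 * δ - min t δ ≠ 0 := by
    have h1 : min t δ ≤ δ := min_le_right _ _
    exact (by linarith : 0 < 2 * δ - min t δ).ne'
  unfold squash
  exact ContinuousAt.mul (by fun_prop) (ContinuousAt.div (by fun_prop) (by fun_prop) h3)

theorem continuousAt_unsquash {δ s : ℝ} (hδ : 0 < δ) (hs : 0 < s) :
    ContinuousAt (fun p : ℝ × ℝ => unsquash p.1 p.2) (δ, s) := by
  unfold unsquash
  exact ContinuousAt.sub (by fun_prop)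
    (ContinuousAt.div (by fun_prop) (by fun_prop) (lt_min hs hδ).ne')

theorem tendsto_squash {δ : ℝ} (hδ : 0 < δ) :
    Tendsto (fun p : ℝ × ℝ => squash p.1 p.2) (𝓝 δ ×ˢ atBot) (𝓝 0) := by
  have h1 : Tendsto (fun p : ℝ × ℝ => p.1 ^ 2 / (2 * p.1 - p.2)) (𝓝 δ ×ˢ atBot) (𝓝 0) := by
    have hf : Tendsto (fun p : ℝ × ℝ => p.1) (𝓝 δ ×ˢ atBot) (𝓝 δ) := tendsto_fst
    have hs : Tendsto (fun p : ℝ × ℝ => -p.2) (𝓝 δ ×ˢ (atBot : Filter ℝ)) atTop :=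
      tendsto_neg_atBot_atTop.comp tendsto_snd
    refine (hf.pow 2).div_atTop ?_
    simpa [sub_eq_add_neg] using (hf.const_mul 2).add_atTop hs
  refine h1.congr' ?_
  have h2 : ∀ᶠ p : ℝ × ℝ in 𝓝 δ ×ˢ atBot, 0 < p.1 ∧ p.2 ≤ 0 :=
    (lt_mem_nhds hδ).prod_mk (eventually_le_atBot 0)
  filter_upwards [h2] with p hp
  rw [squash_of_ge (by linarith)]

theorem tendsto_unsquash {δ : ℝ} (hδ : 0 < δ) :
    Tendsto (fun p : ℝ × ℝ => unsquash p.1 p.2) (𝓝 δ ×ˢ 𝓝[>] 0) atBot := by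
  have hf : Tendsto (fun p : ℝ × ℝ => p.1) (𝓝 δ ×ˢ 𝓝[>] 0) (𝓝 δ) := tendsto_fst
  have hs : Tendsto (fun p : ℝ × ℝ => p.2⁻¹) (𝓝 δ ×ˢ 𝓝[>] (0 : ℝ)) atTop :=
    tendsto_inv_nhdsGT_zero.comp tendsto_snd
  have h1 : Tendsto (fun p : ℝ × ℝ => 2 * p.1 + -(p.1 ^ 2 * p.2⁻¹)) (𝓝 δ ×ˢ 𝓝[>] 0) atBot :=
    (hf.const_mul 2).add_atBot
      (tendsto_neg_atTop_atBot.comp ((hf.pow 2).pos_mul_atTop (by positivity) hs))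
  refine h1.congr' ?_
  have h2 : ∀ᶠ p : ℝ × ℝ in 𝓝 δ ×ˢ 𝓝[>] 0, δ / 2 < p.1 ∧ p.2 < δ / 2 :=
    (lt_mem_nhds (half_lt_self hδ)).prod_mk (nhdsWithin_le_nhds (gt_mem_nhds (half_pos hδ)))
  filter_upwards [h2] with p hp
  rw [unsquash_of_ge (by linarith)]
  ring

variable {X : Type*}

open Classical in
/-- Conjugate `G` by squashings onto the half-space above level `a`, and extend by the identity. -/
noncomputable def squashConj (a : ℝ) (G : X × ℝ → X × ℝ) (δ₁ δ₂ : X → ℝ) (p : X × ℝ) : X × ℝ :=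
  if p.2 ≤ a then p else
    ((G (p.1, a + unsquash (δ₂ p.1) (p.2 - a))).1,
      a + squash (δ₁ (G (p.1, a + unsquash (δ₂ p.1) (p.2 - a))).1)
        ((G (p.1, a + unsquash (δ₂ p.1) (p.2 - a))).2 - a))

theorem exists_squashConj_fst_eq {a : ℝ} {G : X × ℝ → X × ℝ} {δ₁ δ₂ : X → ℝ} {p : X × ℝ}
    (hp : a < p.2) : ∃ s, (squashConj a G δ₁ δ₂ p).1 = (G (p.1, s)).1 :=
  ⟨a + unsquash (δ₂ p.1) (p.2 - a), by rw [squashConj, if_neg (not_le.2 hp)]⟩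

theorem squashConj_squashConj {a : ℝ} {G G' : X × ℝ → X × ℝ} (hG : ∀ p, G (G' p) = p)
    {δ₁ δ₂ : X → ℝ} (h₁ : ∀ x, 0 < δ₁ x) (h₂ : ∀ x, 0 < δ₂ x) (p : X × ℝ) :
    squashConj a G δ₁ δ₂ (squashConj a G' δ₂ δ₁ p) = p := by
  rcases p with ⟨x, t⟩
  by_cases ht : t ≤ a
  · simp [squashConj, ht]
  · have hpos := squash_pos (h₂ (G' (x, a + unsquash (δ₁ x) (t - a))).1)
      ((G' (x, a + unsquash (δ₁ x) (t - a))).2 - a)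
    have h1 : squashConj a G' δ₂ δ₁ (x, t) = _ := if_neg ht
    rw [h1, squashConj, if_neg (by simpa using hpos)]
    simp only [add_sub_cancel_left, unsquash_squash (h₂ _), add_sub_cancel, Prod.mk.eta, hG]
    rw [squash_unsquash (h₁ x) (by linarith)]
    simp

theorem continuous_squashConj [TopologicalSpace X] {a : ℝ} {G : X × ℝ → X × ℝ} (hG : Continuous G)
    (hD : ∀ x, Tendsto G (𝓝 x ×ˢ atBot) (𝓝 x ×ˢ atBot)) {δ₁ δ₂ : X → ℝ}
    (h₁ : ∀ x, 0 < δ₁ x) (h₂ : ∀ x, 0 < δ₂ x) (c₁ : Continuous δ₁) (c₂ : Continuous δ₂) :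
    Continuous (squashConj a G δ₁ δ₂) := by
  rw [continuous_iff_continuousAt]
  rintro ⟨x, t⟩
  rcases lt_trichotomy t a with ht | rfl | ht
  · have : squashConj a G δ₁ δ₂ =ᶠ[𝓝 (x, t)] id := by
      filter_upwards [(isOpen_lt continuous_snd continuous_const).mem_nhds
        (show (x, t).2 < a from ht)] with p hp
      exact if_pos (le_of_lt hp)
    exact continuousAt_id.congr this.symm
  · have hval : squashConj t G δ₁ δ₂ (x, t) = (x, t) := if_pos le_rfl
    rw [ContinuousAt, hval]
    have hun : (univ : Set (X × ℝ)) = {p | p.2 ≤ t} ∪ {p | t < p.2} := by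
      ext p
      simp [le_or_gt]
    have hle : 𝓝 (x, t) ≤ 𝓝[{p | p.2 ≤ t}] (x, t) ⊔ 𝓝[{p | t < p.2}] (x, t) := by
      rw [← nhdsWithin_union, ← hun, nhdsWithin_univ]
    refine Tendsto.mono_left (Tendsto.sup ?_ ?_) hle
    · refine (tendsto_id.mono_left nhdsWithin_le_nhds).congr' ?_
      filter_upwards [self_mem_nhdsWithin] with p hp
      exact (if_pos hp).symm
    · have hx : Tendsto (fun p : X × ℝ => p.1) (𝓝[{p | t < p.2}] (x, t)) (𝓝 x) :=
        (continuous_fst.tendsto (x, t)).mono_left nhdsWithin_le_nhds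
      have ht : Tendsto (fun p : X × ℝ => p.2 - t) (𝓝[{p | t < p.2}] (x, t)) (𝓝[>] 0) := by
        refine tendsto_nhdsWithin_iff.2 ⟨?_, ?_⟩
        · have : Continuous fun p : X × ℝ => p.2 - t := by fun_prop
          simpa using (this.tendsto (x, t)).mono_left nhdsWithin_le_nhds
        · filter_upwards [self_mem_nhdsWithin] with p hp
          exact sub_pos.2 hp
      have h1 := (tendsto_unsquash (h₂ x)).comp (((c₂.tendsto x).comp hx).prodMk ht)
      have h2 := (hD x).comp (hx.prodMk (tendsto_const_nhds (x := t).add_atBot h1))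
      have h3 : Tendsto _ _ _ := tendsto_fst.comp h2
      have h4 : Tendsto _ _ _ := tendsto_snd.comp h2
      have h5 := (tendsto_squash (h₁ x)).comp (((c₁.tendsto x).comp h3).prodMk
        (tendsto_atBot_add_const_right _ (-t) h4))
      have h6 := h3.prodMk_nhds (h5.const_add t)
      rw [add_zero] at h6
      refine h6.congr' ?_
      filter_upwards [self_mem_nhdsWithin] with p hp
      exact (if_neg (not_le.2 hp)).symm
  · have h0 : Tendsto (fun p : X × ℝ => (δ₂ p.1, p.2 - a)) (𝓝 (x, t)) (𝓝 (δ₂ x, t - a)) :=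
      (by fun_prop : Continuous fun p : X × ℝ => (δ₂ p.1, p.2 - a)).tendsto (x, t)
    have h1 : Tendsto _ _ _ := (continuousAt_unsquash (h₂ x) (sub_pos.2 ht)).tendsto.comp h0
    have h2 := (hG.tendsto _).comp
      ((continuous_fst.tendsto (x, t)).prodMk_nhds (h1.const_add a))
    have h3 := ((continuous_fst (X := X) (Y := ℝ)).tendsto _).comp h2
    have h4 := ((continuous_snd (X := X) (Y := ℝ)).tendsto _).comp h2
    have h5 : Tendsto _ _ _ := (continuousAt_squash (h₁ _) _).tendsto.comp
      (((c₁.tendsto _).comp h3).prodMk_nhds (h4.sub_const a))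
    have h6 := h3.prodMk_nhds (h5.const_add a)
    rw [ContinuousAt, show squashConj a G δ₁ δ₂ (x, t) = _ from if_neg (not_le.2 ht)]
    refine h6.congr' ?_
    filter_upwards [(isOpen_lt continuous_const continuous_snd).mem_nhds
      (show a < (x, t).2 from ht)] with p hp
    exact (if_neg (not_le.2 hp)).symm

/-- A homeomorphism of `X × ℝ` fixing the lower end pointwise can be replaced by the identity below
a given level. -/
theorem exists_homeomorph_eq_id_of_le [MetricSpace X] (G : (X × ℝ) ≃ₜ (X × ℝ))
    (hD : ∀ x, Tendsto G (𝓝 x ×ˢ atBot) (𝓝 x ×ˢ atBot))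
    (hD' : ∀ x, Tendsto G.symm (𝓝 x ×ˢ atBot) (𝓝 x ×ˢ atBot)) {a b : ℝ} (hab : a < b)
    (hGab : ∀ p : X × ℝ, b ≤ p.2 → a < (G p).2) :
    ∃ K : (X × ℝ) ≃ₜ (X × ℝ), (∀ p, p.2 ≤ a → K p = p) ∧ (∀ p, b ≤ p.2 → K p = G p) ∧
      (∀ p, a < p.2 → ∃ s, (K p).1 = (G (p.1, s)).1) ∧
      (∀ p, a < p.2 → ∃ s, (K.symm p).1 = (G.symm (p.1, s)).1) := by
  set S : Set (X × ℝ) := G.symm ⁻¹' {p | b ≤ p.2} with hS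
  have hSc : IsClosed S := (isClosed_le continuous_const continuous_snd).preimage G.symm.continuous
  let δ₁ : X → ℝ := fun x => min 1 (Metric.infDist (x, a) S)
  let δ₂ : X → ℝ := fun _ => b - a
  have c₁ : Continuous δ₁ := continuous_const.min
    ((Metric.continuous_infDist_pt S).comp (by fun_prop))
  have h₁ : ∀ x, 0 < δ₁ x := by
    intro x
    refine lt_min one_pos ?_
    refine (hSc.notMem_iff_infDist_pos ⟨G (x, b), ?_⟩).1 fun hx => ?_
    · simp [hS]
    · have := hGab _ hx
      simp at this
  have h₂ : ∀ x, 0 < δ₂ x := fun _ => sub_pos.2 hab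
  refine ⟨{
    toFun := squashConj a G δ₁ δ₂
    invFun := squashConj a G.symm δ₂ δ₁
    left_inv := squashConj_squashConj G.symm_apply_apply h₂ h₁
    right_inv := squashConj_squashConj G.apply_symm_apply h₁ h₂
    continuous_toFun := continuous_squashConj G.continuous hD h₁ h₂ c₁ continuous_const
    continuous_invFun := continuous_squashConj G.symm.continuous hD' h₂ h₁ continuous_const c₁ },
    fun p hp => if_pos hp, fun p hp => ?_,
    fun _ hp => exists_squashConj_fst_eq hp,
    fun _ hp => exists_squashConj_fst_eq hp⟩
  · change squashConj a G δ₁ δ₂ p = G p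
    have h3 : δ₂ p.1 ≤ p.2 - a := by simp only [δ₂]; linarith
    rw [squashConj, if_neg (by linarith), unsquash_of_le h3, add_sub_cancel, squash_of_le (h₁ (G p).1)]
    · simp
    · have hmem : G p ∈ S := by simpa [hS] using hp
      refine (min_le_right _ _).trans ((Metric.infDist_le_dist_of_mem hmem).trans ?_)
      have := hGab p hp
      rw [Prod.dist_eq, dist_self, dist_comm, Real.dist_eq, abs_of_pos (sub_pos.2 this)]
      exact max_le (sub_pos.2 this).le le_rfl

end Squash

section Shear

open Filter Topology

noncomputable def logShear (c t : ℝ) : ℝ := Real.log (1 + max 0 (c - t))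

theorem continuous_logShear (c : ℝ) : Continuous (logShear c) := by
  unfold logShear
  refine Continuous.log (by fun_prop) fun t => ?_
  have : 0 ≤ max 0 (c - t) := le_max_left _ _
  positivity

theorem logShear_of_le {c t : ℝ} (h : c ≤ t) : logShear c t = 0 := by
  rw [logShear, max_eq_left (by linarith), add_zero, Real.log_one]

theorem logShear_nonneg (c t : ℝ) : 0 ≤ logShear c t :=
  Real.log_nonneg (by linarith [le_max_left 0 (c - t)])

theorem tendsto_max_zero_sub_atBot (c : ℝ) : Tendsto (fun t => 1 + max 0 (c - t)) atBot atTop := by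
  have h1 : Tendsto (fun t : ℝ => c - t) atBot atTop := by
    simpa [sub_eq_add_neg] using tendsto_atTop_add_const_left atBot c tendsto_neg_atBot_atTop
  refine tendsto_atTop_add_const_left _ 1 (tendsto_atTop_mono (fun t => ?_) h1)
  exact le_max_right _ _

theorem tendsto_logShear_atBot (c : ℝ) : Tendsto (logShear c) atBot atTop :=
  Real.tendsto_log_atTop.comp (tendsto_max_zero_sub_atBot c)

theorem log_one_add_sub_le {r s : ℝ} (hr : 0 ≤ r) (hs : 0 ≤ s) :
    Real.log (1 + s) - Real.log (1 + r) ≤ |s - r| / (1 + r) := by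
  rw [← Real.log_div (by positivity) (by positivity)]
  refine (Real.log_le_sub_one_of_pos (by positivity)).trans ?_
  rw [div_sub_one (by positivity)]
  gcongr
  linarith [le_abs_self (s - r)]

theorem abs_logShear_sub_le {c C s t : ℝ} (h : |s - t| ≤ C) :
    |logShear c s - logShear c t| ≤ C / (1 + max 0 (c - s)) + C / (1 + max 0 (c - t)) := by
  have hC : 0 ≤ C := (abs_nonneg _).trans h
  have hs : 0 ≤ max 0 (c - s) := le_max_left _ _
  have ht : 0 ≤ max 0 (c - t) := le_max_left _ _
  have hst : |max 0 (c - s) - max 0 (c - t)| ≤ C := by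
    rw [max_comm 0, max_comm 0]
    refine (abs_max_sub_max_le_abs _ _ _).trans ?_
    rwa [sub_sub_sub_cancel_left, abs_sub_comm]
  have h1 := log_one_add_sub_le ht hs
  have h2 := log_one_add_sub_le hs ht
  rw [abs_sub_comm] at h2
  have h3 : |max 0 (c - s) - max 0 (c - t)| / (1 + max 0 (c - t)) ≤ C / (1 + max 0 (c - t)) := by
    gcongr
  have h4 : |max 0 (c - s) - max 0 (c - t)| / (1 + max 0 (c - s)) ≤ C / (1 + max 0 (c - s)) := by
    gcongr
  have h5 : 0 ≤ C / (1 + max 0 (c - t)) := by positivity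
  have h6 : 0 ≤ C / (1 + max 0 (c - s)) := by positivity
  unfold logShear
  rw [abs_le]
  constructor <;> linarith

theorem abs_logShear_sub_le_two_mul {c C s t : ℝ} (h : |s - t| ≤ C) :
    |logShear c s - logShear c t| ≤ 2 * C := by
  have hC : 0 ≤ C := (abs_nonneg _).trans h
  have hs : C / (1 + max 0 (c - s)) ≤ C := div_le_self hC (by linarith [le_max_left 0 (c - s)])
  have ht : C / (1 + max 0 (c - t)) ≤ C := div_le_self hC (by linarith [le_max_left 0 (c - t)])
  linarith [abs_logShear_sub_le (c := c) h]

variable {Y : Type*}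

/-- Shearing in the second coordinate by a function of the third. -/
noncomputable def shear [TopologicalSpace Y] (c : ℝ) : ((Y × ℝ) × ℝ) ≃ₜ ((Y × ℝ) × ℝ) where
  toFun p := ((p.1.1, p.1.2 + logShear c p.2), p.2)
  invFun p := ((p.1.1, p.1.2 - logShear c p.2), p.2)
  left_inv p := by simp
  right_inv p := by simp
  continuous_toFun := by
    have := continuous_logShear c
    fun_prop
  continuous_invFun := by
    have := continuous_logShear c
    fun_prop

/-- `f` is asymptotic to the identity in the first two coordinates as the second one tends to
`-∞`, uniformly in the third one. -/
def AsymptoticToId [TopologicalSpace Y] (f : (Y × ℝ) × ℝ → (Y × ℝ) × ℝ) : Prop :=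
  ∀ y, Tendsto (fun p => ((f p).1.1, (f p).1.2 - p.1.2)) ((𝓝 y ×ˢ atBot) ×ˢ ⊤) (𝓝 y ×ˢ 𝓝 0)

/-- `f` fixes the end where the second coordinate tends to `-∞`. -/
def FixesEnd [TopologicalSpace Y] (f : (Y × ℝ) × ℝ → (Y × ℝ) × ℝ) : Prop :=
  ∀ y, Tendsto f ((𝓝 y ×ˢ atBot) ×ˢ ⊤) ((𝓝 y ×ˢ atBot) ×ˢ ⊤)

section

variable [TopologicalSpace Y] {f : (Y × ℝ) × ℝ → (Y × ℝ) × ℝ} {C c : ℝ}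

theorem AsymptoticToId.tendsto_shear_conj (hf : AsymptoticToId f) (hC : ∀ p, |(f p).2 - p.2| ≤ C)
    (x : Y × ℝ) :
    Tendsto (fun p => shear c (f ((shear c).symm p))) (𝓝 x ×ˢ atBot) (𝓝 x ×ˢ atBot) := by
  obtain ⟨y, a⟩ := x
  have ht : Tendsto (fun p : (Y × ℝ) × ℝ => p.2) (𝓝 (y, a) ×ˢ atBot) atBot := tendsto_snd
  have hx : Tendsto (fun p : (Y × ℝ) × ℝ => p.1) (𝓝 (y, a) ×ˢ atBot) (𝓝 (y, a)) := tendsto_fst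
  have hy : Tendsto (fun p : (Y × ℝ) × ℝ => p.1.1) (𝓝 (y, a) ×ˢ atBot) (𝓝 y) :=
    (continuous_fst.tendsto _).comp hx
  have ha : Tendsto (fun p : (Y × ℝ) × ℝ => p.1.2) (𝓝 (y, a) ×ˢ atBot) (𝓝 a) :=
    (continuous_snd.tendsto _).comp hx
  have hσ : Tendsto (fun p : (Y × ℝ) × ℝ => -logShear c p.2) (𝓝 (y, a) ×ˢ atBot) atBot :=
    tendsto_neg_atTop_atBot.comp ((tendsto_logShear_atBot c).comp ht)
  have hΘ : Tendsto (shear c (Y := Y)).symm (𝓝 (y, a) ×ˢ atBot) ((𝓝 y ×ˢ atBot) ×ˢ ⊤) :=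
    (hy.prodMk (ha.add_atBot hσ)).prodMk tendsto_top
  have hq := (hf y).comp hΘ
  have hq1 : Tendsto _ _ _ := tendsto_fst.comp hq
  have hq2 : Tendsto _ _ _ := tendsto_snd.comp hq
  have hb : Tendsto (fun p => (f ((shear c).symm p)).2) (𝓝 (y, a) ×ˢ atBot) atBot := by
    refine tendsto_atBot_mono (fun p => ?_) (tendsto_atBot_add_const_right _ C ht)
    have := (abs_le.1 (hC ((shear c).symm p))).2
    have h2 : ((shear c).symm p).2 = p.2 := rfl
    linarith
  have hdiff : Tendsto (fun p => logShear c (f ((shear c).symm p)).2 - logShear c p.2)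
      (𝓝 (y, a) ×ˢ atBot) (𝓝 0) := by
    have h1 := ((tendsto_max_zero_sub_atBot c).comp hb).const_div_atTop C
    have h2 := ((tendsto_max_zero_sub_atBot c).comp ht).const_div_atTop C
    have h3 := h1.add h2
    rw [add_zero] at h3
    exact squeeze_zero_norm (fun p => abs_logShear_sub_le (hC ((shear c).symm p))) h3
  have hfin := (hq2.add hdiff).add ha
  rw [zero_add, zero_add] at hfin
  refine Tendsto.prodMk ?_ hb
  refine Tendsto.prodMk_nhds hq1 (hfin.congr fun p => ?_)
  change (f ((shear c).symm p)).1.2 - (p.1.2 - logShear c p.2) + (_ - _) + p.1.2 =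
    (f ((shear c).symm p)).1.2 + logShear c (f ((shear c).symm p)).2
  ring

theorem AsymptoticToId.fixesEnd_shear_conj (hf : AsymptoticToId f)
    (hC : ∀ p, |(f p).2 - p.2| ≤ C) :
    FixesEnd (fun p => shear c (f ((shear c).symm p))) := by
  intro y
  have hy : Tendsto (fun p : (Y × ℝ) × ℝ => p.1.1) ((𝓝 y ×ˢ atBot) ×ˢ ⊤) (𝓝 y) :=
    tendsto_fst.comp tendsto_fst
  have ha : Tendsto (fun p : (Y × ℝ) × ℝ => p.1.2) ((𝓝 y ×ˢ atBot) ×ˢ ⊤) atBot :=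
    tendsto_snd.comp tendsto_fst
  have hΘ : Tendsto (shear c (Y := Y)).symm ((𝓝 y ×ˢ atBot) ×ˢ ⊤) ((𝓝 y ×ˢ atBot) ×ˢ ⊤) :=
    (hy.prodMk (tendsto_atBot_mono (fun p => sub_le_self _ (logShear_nonneg c p.2)) ha)).prodMk
      tendsto_top
  have hq := (hf y).comp hΘ
  have hq1 : Tendsto _ _ _ := tendsto_fst.comp hq
  have hq2 : Tendsto _ _ _ := tendsto_snd.comp hq
  refine (hq1.prodMk (tendsto_atBot_mono (fun p => ?_)
    ((hq2.add_atBot ha).atBot_add (tendsto_const_nhds (x := 2 * C))))).prodMk tendsto_top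
  have h1 := (abs_le.1 (abs_logShear_sub_le_two_mul (c := c) (hC ((shear c).symm p)))).2
  have h2 : ((shear c).symm p).2 = p.2 := rfl
  have h3 : ((shear c).symm p).1.2 = p.1.2 - logShear c p.2 := rfl
  rw [h2] at h1
  change (f ((shear c).symm p)).1.2 + logShear c (f ((shear c).symm p)).2 ≤
    (f ((shear c).symm p)).1.2 - ((shear c).symm p).1.2 + p.1.2 + 2 * C
  rw [h3]
  linarith

end

theorem FixesEnd.of_forall_fst [TopologicalSpace Y] {G K : (Y × ℝ) × ℝ → (Y × ℝ) × ℝ}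
    (hG : FixesEnd G) (hK : ∀ p, K p = p ∨ ∃ s, (K p).1 = (G (p.1, s)).1) : FixesEnd K := by
  intro y
  have h1 := hG y
  simp only [prod_top, tendsto_comap_iff, Function.comp_def] at h1 ⊢
  intro V hV
  obtain ⟨U, hU, hUV⟩ := h1 hV
  refine ⟨U ∩ V, inter_mem hU hV, fun p hp => ?_⟩
  rcases hK p with h | ⟨s, h⟩
  · simpa [h] using hp.2
  · simp only [mem_preimage, h]
    exact hUV (show (p.1, s) ∈ Prod.fst ⁻¹' U from hp.1)

theorem exists_homeomorph_eq_id_of_le_of_asymptoticToId [MetricSpace Y]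
    (f : ((Y × ℝ) × ℝ) ≃ₜ ((Y × ℝ) × ℝ)) {C : ℝ} (hC : ∀ p, |(f p).2 - p.2| ≤ C)
    (hf : AsymptoticToId f) (hf' : AsymptoticToId f.symm) {a b : ℝ} (hab : a < b)
    (hfab : ∀ p : (Y × ℝ) × ℝ, b ≤ p.2 → a < (f p).2) :
    ∃ K : ((Y × ℝ) × ℝ) ≃ₜ ((Y × ℝ) × ℝ), (∀ p, p.2 ≤ a → K p = p) ∧
      (∀ p, b ≤ p.2 → K p = f p) ∧ FixesEnd K ∧ FixesEnd K.symm := by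
  have hC' : ∀ p, |(f.symm p).2 - p.2| ≤ C := fun p => by
    simpa [abs_sub_comm] using hC (f.symm p)
  let G := (shear (b - C)).symm.trans (f.trans (shear (b - C)))
  obtain ⟨K, hK1, hK2, hK3, hK4⟩ := exists_homeomorph_eq_id_of_le G
    (hf.tendsto_shear_conj hC) (hf'.tendsto_shear_conj hC') hab (fun p hp => by
      have h1 : logShear (b - C) p.2 = 0 := logShear_of_le (by linarith [(abs_nonneg _).trans (hC p)])
      have h2 : (shear (b - C)).symm p = p := by simp [shear, h1]
      change a < (f ((shear (b - C)).symm p)).2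
      rw [h2]
      exact hfab p hp)
  have hKs : ∀ p, p.2 ≤ a → K.symm p = p := fun p hp => by
    rw [K.symm_apply_eq, hK1 p hp]
  refine ⟨K, hK1, fun p hp => ?_,
    (hf.fixesEnd_shear_conj hC (c := b - C)).of_forall_fst fun p => ?_,
    (hf'.fixesEnd_shear_conj hC' (c := b - C)).of_forall_fst fun p => ?_⟩
  · have h1 : logShear (b - C) p.2 = 0 := logShear_of_le (by linarith [(abs_nonneg _).trans (hC p)])
    have h2 : (shear (b - C)).symm p = p := by simp [shear, h1]
    have h3 : logShear (b - C) (f p).2 = 0 := logShear_of_le (by linarith [(abs_le.1 (hC p)).1])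
    have h4 : shear (b - C) (f p) = f p := by simp [shear, h3]
    rw [hK2 p hp]
    change shear (b - C) (f ((shear (b - C)).symm p)) = f p
    rw [h2, h4]
  · exact (le_or_gt p.2 a).imp (hK1 p) (hK3 p)
  · exact (le_or_gt p.2 a).imp (hKs p) (hK4 p)

end Shear

section Slow

open Filter Topology

/-- A slowly varying function: it lies between `k` and `k + 1` on `[c (k + 1), c k]` if the
sequence `c` decreases by steps of size at least one. -/
noncomputable def slowCount (c : ℕ → ℝ) (u : ℝ) : ℝ := ⨅ k : ℕ, ((k : ℝ) + max 0 (c k - u))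

variable {c : ℕ → ℝ}

theorem bddBelow_slowCount (u : ℝ) : BddBelow (range fun k : ℕ => ((k : ℝ) + max 0 (c k - u))) :=
  ⟨0, by rintro _ ⟨k, rfl⟩; have := le_max_left 0 (c k - u); positivity⟩

theorem slowCount_nonneg (u : ℝ) : 0 ≤ slowCount c u :=
  le_ciInf fun k => by have := le_max_left 0 (c k - u); positivity

theorem slowCount_le_of_le {k : ℕ} {u : ℝ} (h : c k ≤ u) : slowCount c u ≤ k := by
  refine (ciInf_le (bddBelow_slowCount u) k).trans ?_
  rw [max_eq_left (by linarith), add_zero]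

theorem le_slowCount_of_le (hc : ∀ k, c (k + 1) ≤ c k - 1) {k : ℕ} {u : ℝ} (h : u ≤ c k) :
    k ≤ slowCount c u := by
  refine le_ciInf fun j => ?_
  rcases le_or_gt k j with hkj | hkj
  · have h1 : (k : ℝ) ≤ j := by exact_mod_cast hkj
    linarith [le_max_left 0 (c j - u)]
  · have h1 : ∀ i : ℕ, c (j + i) ≤ c j - i := by
      intro i
      induction i with
      | zero => simp
      | succ i ih =>
        have := hc (j + i)
        push_cast
        rw [← add_assoc]
        linarith
    have h2 := h1 (k - j)
    rw [Nat.add_sub_cancel' hkj.le, Nat.cast_sub hkj.le] at h2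
    linarith [le_max_right 0 (c j - u)]

theorem antitone_slowCount : Antitone (slowCount c) := fun u v huv =>
  ciInf_mono (bddBelow_slowCount v) fun k => by gcongr

theorem slowCount_le_add (u v : ℝ) : slowCount c u ≤ slowCount c v + |u - v| := by
  rw [← sub_le_iff_le_add]
  refine le_ciInf fun k => ?_
  rw [sub_le_iff_le_add]
  refine (ciInf_le (bddBelow_slowCount u) k).trans ?_
  rw [add_assoc]
  gcongr
  refine max_le (add_nonneg (le_max_left _ _) (abs_nonneg _)) ?_
  linarith [le_max_right 0 (c k - v), neg_abs_le (u - v)]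

theorem continuous_slowCount : Continuous (slowCount c) := by
  refine (LipschitzWith.of_dist_le_mul (K := 1) fun u v => ?_).continuous
  rw [NNReal.coe_one, one_mul, Real.dist_eq, Real.dist_eq, abs_le]
  have h1 := slowCount_le_add (c := c) u v
  have h2 := slowCount_le_add (c := c) v u
  rw [abs_sub_comm v u] at h2
  constructor <;> linarith

theorem tendsto_slowCount (hc : ∀ k, c (k + 1) ≤ c k - 1) :
    Tendsto (slowCount c) atBot atTop := by
  refine tendsto_atTop.2 fun b => ?_
  obtain ⟨k, hk⟩ := exists_nat_ge b
  filter_upwards [eventually_le_atBot (c k)] with u hu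
  exact hk.trans (le_slowCount_of_le hc hu)

/-- A coordinate on the line in which moving a bounded number of steps along the sequence `c`
becomes a small displacement. -/
noncomputable def slowCoord (c : ℕ → ℝ) (u : ℝ) : ℝ := Real.exp u - Real.log (1 + slowCount c u)

theorem continuous_slowCoord : Continuous (slowCoord c) :=
  Real.continuous_exp.sub ((continuous_const.add continuous_slowCount).log fun u => by
    have := slowCount_nonneg (c := c) u
    exact (by positivity : 0 < 1 + slowCount c u).ne')

theorem strictMono_slowCoord : StrictMono (slowCoord c) := by
  intro u v huv
  have h0 := slowCount_nonneg (c := c) v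
  have h1 : Real.log (1 + slowCount c v) ≤ Real.log (1 + slowCount c u) :=
    Real.log_le_log (by positivity) (by linarith [antitone_slowCount (c := c) huv.le])
  have h2 := Real.exp_lt_exp.2 huv
  unfold slowCoord
  linarith

theorem tendsto_slowCoord_atBot (hc : ∀ k, c (k + 1) ≤ c k - 1) :
    Tendsto (slowCoord c) atBot atBot := by
  have h1 : Tendsto (fun u => -Real.log (1 + slowCount c u)) atBot atBot :=
    tendsto_neg_atTop_atBot.comp (Real.tendsto_log_atTop.comp
      (tendsto_atTop_add_const_left _ 1 (tendsto_slowCount hc)))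
  exact (Real.tendsto_exp_atBot.add_atBot h1).congr fun u => (sub_eq_add_neg _ _).symm

theorem tendsto_slowCoord_atTop : Tendsto (slowCoord c) atTop atTop := by
  refine Real.tendsto_exp_atTop.congr' ?_
  filter_upwards [eventually_ge_atTop (c 0)] with u hu
  have : slowCount c u = 0 := le_antisymm (by simpa using slowCount_le_of_le hu) (slowCount_nonneg u)
  simp [slowCoord, this]

noncomputable def slowHomeomorph (hc : ∀ k, c (k + 1) ≤ c k - 1) : ℝ ≃ₜ ℝ :=
  (strictMono_slowCoord.orderIsoOfSurjective (slowCoord c) (continuous_slowCoord.surjective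
    tendsto_slowCoord_atTop (tendsto_slowCoord_atBot hc))).toHomeomorph

theorem tendsto_slowHomeomorph_atBot (hc : ∀ k, c (k + 1) ≤ c k - 1) :
    Tendsto (slowHomeomorph hc) atBot atBot :=
  tendsto_slowCoord_atBot hc

theorem tendsto_slowHomeomorph_symm_atBot (hc : ∀ k, c (k + 1) ≤ c k - 1) :
    Tendsto (slowHomeomorph hc).symm atBot atBot :=
  (strictMono_slowCoord.orderIsoOfSurjective (slowCoord c) (continuous_slowCoord.surjective
    tendsto_slowCoord_atTop (tendsto_slowCoord_atBot hc))).symm.tendsto_atBot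

variable {Y : Type*}

theorem FixesEnd.eventually_forall_le [PseudoMetricSpace Y] [ProperSpace Y]
    {g : (Y × ℝ) × ℝ → (Y × ℝ) × ℝ} (hg : FixesEnd g) (y₀ : Y) (R B : ℝ) :
    ∀ᶠ u in atBot, ∀ y ∈ Metric.closedBall y₀ R, ∀ t, (g ((y, u), t)).1.2 ≤ B := by
  have h1 : ∀ y ∈ Metric.closedBall y₀ R,
      {p : Y × ℝ | ∀ t, (g (p, t)).1.2 ≤ B} ∈ 𝓝 y ×ˢ (atBot : Filter ℝ) := by
    intro y _
    have h2 := (tendsto_snd.comp (tendsto_fst.comp (hg y))).eventually (eventually_le_atBot B)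
    rw [prod_top, eventually_comap] at h2
    filter_upwards [h2] with p hp t
    exact hp (p, t) rfl
  have h3 := (isCompact_closedBall y₀ R).mem_nhdsSet_prod_of_forall h1
  obtain ⟨U, hU, T, hT, hUT⟩ := mem_prod_iff.1 h3
  filter_upwards [hT] with u hu y hy t
  exact hUT ⟨subset_of_mem_nhdsSet hU hy, hu⟩ t

theorem FixesEnd.eventually_slowCount_sub_le [PseudoMetricSpace Y]
    {g : (Y × ℝ) × ℝ → (Y × ℝ) × ℝ} (hc : ∀ k, c (k + 1) ≤ c k - 1) {y₀ : Y}
    (hgc : ∀ k : ℕ, ∀ u ≤ c (k + 1), ∀ y ∈ Metric.closedBall y₀ k, ∀ t,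
      (g ((y, u), t)).1.2 ≤ c k) (y : Y) :
    ∀ᶠ p in (𝓝 y ×ˢ atBot) ×ˢ ⊤, slowCount c p.1.2 - slowCount c (g p).1.2 ≤ 2 := by
  have h1 : ∀ᶠ q in 𝓝 y ×ˢ (atBot : Filter ℝ),
      q.1 ∈ Metric.ball y 1 ∧ max 1 (dist y y₀ + 1) + 2 ≤ slowCount c q.2 :=
    Eventually.prod_mk (Metric.ball_mem_nhds y one_pos)
      ((tendsto_slowCount hc).eventually (eventually_ge_atTop _))
  rw [prod_top, eventually_comap]
  filter_upwards [h1] with q hq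
  rintro ⟨⟨z, u⟩, t⟩ rfl
  obtain ⟨hz, hw⟩ := hq
  simp only [Metric.mem_ball] at hz hw ⊢
  set w := slowCount c u with hwdef
  have hw1 := (add_le_add_left (le_max_left 1 (dist y y₀ + 1)) 2).trans hw
  have hw2 := (add_le_add_left (le_max_right 1 (dist y y₀ + 1)) 2).trans hw
  obtain ⟨k, hk⟩ : ∃ k : ℕ, ⌈w⌉₊ = k + 2 := by
    have : 2 ≤ ⌈w⌉₊ := by
      have := Nat.le_ceil w
      have h2 : (2 : ℝ) ≤ ⌈w⌉₊ := by linarith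
      exact_mod_cast h2
    exact ⟨⌈w⌉₊ - 2, by omega⟩
  have hk1 : w ≤ k + 2 := by
    have := Nat.le_ceil w
    rw [hk] at this
    exact_mod_cast this
  have hk2 : (k : ℝ) + 1 < w := by
    have h2 : k + 1 < ⌈w⌉₊ := by omega
    have := Nat.lt_ceil.1 h2
    exact_mod_cast this
  have hu : u ≤ c (k + 1) := by
    by_contra! hlt
    have := slowCount_le_of_le hlt.le
    push_cast at this
    linarith
  have hzk : z ∈ Metric.closedBall y₀ (k : ℝ) := by
    rw [Metric.mem_closedBall]
    linarith [dist_triangle z y y₀]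
  have := le_slowCount_of_le hc (hgc k u hu z hzk t)
  linarith

/-- Change the second coordinate. -/
def midCongr [TopologicalSpace Y] (α : ℝ ≃ₜ ℝ) : ((Y × ℝ) × ℝ) ≃ₜ ((Y × ℝ) × ℝ) :=
  ((Homeomorph.refl Y).prodCongr α).prodCongr (Homeomorph.refl ℝ)

theorem fixesEnd_midCongr [TopologicalSpace Y] {α : ℝ ≃ₜ ℝ} (hα : Tendsto α atBot atBot) :
    FixesEnd (midCongr α (Y := Y)) := fun _ =>
  (tendsto_id.prodMap hα).prodMap tendsto_id

theorem asymptoticToId_midCongr_conj [TopologicalSpace Y] {g : (Y × ℝ) × ℝ → (Y × ℝ) × ℝ}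
    (hg : FixesEnd g) (hc : ∀ k, c (k + 1) ≤ c k - 1)
    (h : ∀ y, ∀ᶠ p in (𝓝 y ×ˢ atBot) ×ˢ ⊤, |slowCount c (g p).1.2 - slowCount c p.1.2| ≤ 2) :
    AsymptoticToId (fun p => midCongr (slowHomeomorph hc)
      (g ((midCongr (slowHomeomorph hc)).symm p))) := by
  intro y
  have hu : Tendsto (fun p : (Y × ℝ) × ℝ => p.1.2) ((𝓝 y ×ˢ atBot) ×ˢ ⊤) atBot :=
    tendsto_snd.comp tendsto_fst
  have hy' : Tendsto _ _ _ := tendsto_fst.comp (tendsto_fst.comp (hg y))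
  have hu' : Tendsto _ _ _ := tendsto_snd.comp (tendsto_fst.comp (hg y))
  have hw := (tendsto_atTop_add_const_left _ 1 ((tendsto_slowCount hc).comp hu)).const_div_atTop 2
  have hw' := (tendsto_atTop_add_const_left _ 1 ((tendsto_slowCount hc).comp hu')).const_div_atTop 2
  have hlog : Tendsto (fun p => Real.log (1 + slowCount c (g p).1.2) -
      Real.log (1 + slowCount c p.1.2)) ((𝓝 y ×ˢ atBot) ×ˢ ⊤) (𝓝 0) := by
    have h3 := hw.add hw'
    rw [add_zero] at h3
    refine squeeze_zero_norm' ?_ h3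
    filter_upwards [h y] with p hp
    have a0 := slowCount_nonneg (c := c) p.1.2
    have b0 := slowCount_nonneg (c := c) (g p).1.2
    have h1 : _ ≤ 2 / (1 + slowCount c p.1.2) := (log_one_add_sub_le a0 b0).trans (by gcongr)
    have h2 : _ ≤ 2 / (1 + slowCount c (g p).1.2) :=
      (log_one_add_sub_le b0 a0).trans (by rw [abs_sub_comm]; gcongr)
    have h4 : 0 ≤ 2 / (1 + slowCount c p.1.2) := by positivity
    have h5 : 0 ≤ 2 / (1 + slowCount c (g p).1.2) := by positivity
    simp only [Function.comp_apply]
    rw [Real.norm_eq_abs, abs_le]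
    constructor <;> linarith
  have hexp := ((Real.tendsto_exp_atBot.comp hu').sub (Real.tendsto_exp_atBot.comp hu)).sub hlog
  simp only [sub_zero] at hexp
  have hmain : Tendsto (fun p => ((g p).1.1, slowCoord c (g p).1.2 - slowCoord c p.1.2))
      ((𝓝 y ×ˢ atBot) ×ˢ ⊤) (𝓝 y ×ˢ 𝓝 0) := by
    refine hy'.prodMk (hexp.congr fun p => ?_)
    simp only [slowCoord, Function.comp_apply]
    ring
  have hΦ : Tendsto (midCongr (slowHomeomorph hc) (Y := Y)).symm ((𝓝 y ×ˢ atBot) ×ˢ ⊤)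
      ((𝓝 y ×ˢ atBot) ×ˢ ⊤) := fixesEnd_midCongr (tendsto_slowHomeomorph_symm_atBot hc) y
  refine (hmain.comp hΦ).congr fun p => ?_
  have : slowCoord c ((slowHomeomorph hc).symm p.1.2) = p.1.2 :=
    (slowHomeomorph hc).apply_symm_apply p.1.2
  simp only [Function.comp_apply, midCongr, Homeomorph.prodCongr_symm, Homeomorph.refl_symm,
    Homeomorph.coe_prodCongr, Prod.map_fst, Prod.map_snd, this]
  rfl

theorem exists_asymptoticToId_midCongr [PseudoMetricSpace Y] [ProperSpace Y] [Nonempty Y]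
    (g : ((Y × ℝ) × ℝ) ≃ₜ ((Y × ℝ) × ℝ)) (hg : FixesEnd g) (hg' : FixesEnd g.symm) :
    ∃ α : ℝ ≃ₜ ℝ, Tendsto α atBot atBot ∧ Tendsto α.symm atBot atBot ∧
      AsymptoticToId (((midCongr α).symm.trans g).trans (midCongr α)) ∧
      AsymptoticToId (((midCongr α).symm.trans g.symm).trans (midCongr α)) := by
  obtain ⟨y₀⟩ := ‹Nonempty Y›
  have hstep : ∀ (k : ℕ) (b : ℝ), ∃ b' ≤ b - 1, (∀ u ≤ b', ∀ y ∈ Metric.closedBall y₀ (k : ℝ),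
      ∀ t, (g ((y, u), t)).1.2 ≤ b) ∧ (∀ u ≤ b', ∀ y ∈ Metric.closedBall y₀ (k : ℝ),
      ∀ t, (g.symm ((y, u), t)).1.2 ≤ b) := by
    intro k b
    obtain ⟨b₁, hb₁⟩ := eventually_atBot.1 (hg.eventually_forall_le y₀ k b)
    obtain ⟨b₂, hb₂⟩ := eventually_atBot.1 (hg'.eventually_forall_le y₀ k b)
    refine ⟨min (b - 1) (min b₁ b₂), min_le_left _ _, fun u hu => hb₁ u ?_, fun u hu => hb₂ u ?_⟩
    · exact hu.trans ((min_le_right _ _).trans (min_le_left _ _))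
    · exact hu.trans ((min_le_right _ _).trans (min_le_right _ _))
  choose next hnext hnext₁ hnext₂ using hstep
  let c : ℕ → ℝ := fun k => Nat.rec 0 next k
  have hc : ∀ k, c (k + 1) ≤ c k - 1 := fun k => hnext k (c k)
  have h1 := FixesEnd.eventually_slowCount_sub_le (g := g) hc (y₀ := y₀) fun k => hnext₁ k (c k)
  have h2 := FixesEnd.eventually_slowCount_sub_le (g := g.symm) hc (y₀ := y₀) fun k => hnext₂ k (c k)
  refine ⟨slowHomeomorph hc, tendsto_slowHomeomorph_atBot hc, tendsto_slowHomeomorph_symm_atBot hc,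
    asymptoticToId_midCongr_conj hg hc fun y => ?_,
    asymptoticToId_midCongr_conj hg' hc fun y => ?_⟩
  · filter_upwards [h1 y, (hg y).eventually (h2 y)] with p hp1 hp2
    rw [g.symm_apply_apply] at hp2
    rw [abs_le]
    constructor <;> linarith
  · filter_upwards [h2 y, (hg' y).eventually (h1 y)] with p hp1 hp2
    rw [g.apply_symm_apply] at hp2
    rw [abs_le]
    constructor <;> linarith

end Slow

section Interpolation

open Filter Topology

variable {Y : Type*} [MetricSpace Y]

theorem exists_homeomorph_interpolate_of_asymptoticToId (G : ((Y × ℝ) × ℝ) ≃ₜ ((Y × ℝ) × ℝ))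
    (hG : AsymptoticToId G) (hG' : AsymptoticToId G.symm) {C : ℝ} (hC : ∀ p, |(G p).2 - p.2| ≤ C)
    {a b c : ℝ} (hab : a < b) (hbc : b < c) (hc : ∀ p : (Y × ℝ) × ℝ, c ≤ p.2 → b < (G p).2)
    (ha : ∀ p : (Y × ℝ) × ℝ, p.2 ≤ a → (G p).2 < b) :
    ∃ M : ((Y × ℝ) × ℝ) ≃ₜ ((Y × ℝ) × ℝ), FixesEnd M ∧ FixesEnd M.symm ∧
      (∀ p, p.2 ≤ a → M p = p) ∧ (∀ p, c ≤ p.2 → M p = p) ∧ ∀ p, p.2 = b → M p = G.symm p := by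
  have hC' : ∀ p, |(G.symm p).2 - p.2| ≤ C := fun p => by
    simpa [abs_sub_comm] using hC (G.symm p)
  obtain ⟨K₁, h1a, h1b, h1e, h1e'⟩ := exists_homeomorph_eq_id_of_le_of_asymptoticToId G hC hG hG'
    hbc hc
  obtain ⟨K₂, h2a, h2b, h2e, h2e'⟩ := exists_homeomorph_eq_id_of_le_of_asymptoticToId G.symm hC'
    hG' hG hab (fun p hp => by
      by_contra! h
      have := ha _ h
      rw [G.apply_symm_apply] at this
      linarith)
  refine ⟨K₁.trans K₂, fun y => (h2e y).comp (h1e y), fun y => (h1e' y).comp (h2e' y),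
    fun p hp => ?_, fun p hp => ?_, fun p hp => ?_⟩
  · rw [Homeomorph.trans_apply, h1a p (by linarith), h2a p hp]
  · rw [Homeomorph.trans_apply, h1b p hp, h2b _ (hc p hp).le, G.symm_apply_apply]
  · rw [Homeomorph.trans_apply, h1a p hp.le, h2b p hp.ge]

theorem exists_homeomorph_interpolate [ProperSpace Y] [Nonempty Y]
    (g : ((Y × ℝ) × ℝ) ≃ₜ ((Y × ℝ) × ℝ))
    (hg : FixesEnd g) (hg' : FixesEnd g.symm) {C : ℝ} (hC : ∀ p, |(g p).2 - p.2| ≤ C)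
    {a b c : ℝ} (hab : a < b) (hbc : b < c) (hc : ∀ p : (Y × ℝ) × ℝ, c ≤ p.2 → b < (g p).2)
    (ha : ∀ p : (Y × ℝ) × ℝ, p.2 ≤ a → (g p).2 < b) :
    ∃ M : ((Y × ℝ) × ℝ) ≃ₜ ((Y × ℝ) × ℝ), FixesEnd M ∧ FixesEnd M.symm ∧
      (∀ p, p.2 ≤ a → M p = p) ∧ (∀ p, c ≤ p.2 → M p = p) ∧ ∀ p, p.2 = b → M p = g.symm p := by
  obtain ⟨α, hα, hα', hG, hG'⟩ := exists_asymptoticToId_midCongr g hg hg'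
  obtain ⟨M, hM, hM', hMa, hMc, hMb⟩ := exists_homeomorph_interpolate_of_asymptoticToId
    (((midCongr α).symm.trans g).trans (midCongr α)) hG hG' (C := C)
    (fun p => hC ((midCongr α).symm p)) hab hbc (fun p hp => hc ((midCongr α).symm p) hp)
    (fun p hp => ha ((midCongr α).symm p) hp)
  have hΦ := fixesEnd_midCongr (Y := Y) hα
  have hΦ' : FixesEnd (midCongr (Y := Y) α).symm := fixesEnd_midCongr (Y := Y) (α := α.symm) hα'
  refine ⟨((midCongr α).trans M).trans (midCongr α).symm,
    fun y => (hΦ' y).comp ((hM y).comp (hΦ y)), fun y => (hΦ' y).comp ((hM' y).comp (hΦ y)),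
    fun p hp => ?_, fun p hp => ?_, fun p hp => ?_⟩
  · change (midCongr α).symm (M (midCongr α p)) = p
    rw [hMa (midCongr α p) hp, (midCongr α).symm_apply_apply]
  · change (midCongr α).symm (M (midCongr α p)) = p
    rw [hMc (midCongr α p) hp, (midCongr α).symm_apply_apply]
  · change (midCongr α).symm (M (midCongr α p)) = g.symm p
    rw [hMb (midCongr α p) hp]
    change (midCongr α).symm (midCongr α (g.symm ((midCongr α).symm (midCongr α p)))) = _
    rw [(midCongr α).symm_apply_apply, (midCongr α).symm_apply_apply]

end Interpolation

section AngleControl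

open Real

/-- `τ : X × ℝ → ℝ`, seen as a family of maps of angles, sends the horizontal directions into
the open half-planes around them, and only angles in the open upper (resp. lower) half-plane to
the upward (resp. downward) vertical direction. -/
structure IsAngleControlled {X : Type*} [TopologicalSpace X] (τ : X × ℝ → ℝ) : Prop where
  continuous : Continuous τ
  cos_mul_cos_pos : ∀ p, sin p.2 = 0 → 0 < cos p.2 * cos (τ p)
  sin_mul_sin_pos : ∀ p, cos (τ p) = 0 → 0 < sin p.2 * sin (τ p)

namespace IsAngleControlled

variable {X : Type*} [TopologicalSpace X] {τ : X × ℝ → ℝ}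

theorem shift (h : IsAngleControlled τ) (k : ℤ) :
    IsAngleControlled fun p : X × ℝ => τ (p.1, p.2 + k * π) - k * π where
  continuous := by have := h.continuous; fun_prop
  cos_mul_cos_pos p hp := by
    have := h.cos_mul_cos_pos (p.1, p.2 + k * π) (by
      rw [sin_add_int_mul_pi, hp, mul_zero])
    rw [cos_sub_int_mul_pi]
    simp only [cos_add_int_mul_pi] at this
    linarith
  sin_mul_sin_pos p hp := by
    rw [cos_sub_int_mul_pi] at hp
    have := h.sin_mul_sin_pos (p.1, p.2 + k * π) (by
      rcases mul_eq_zero.mp hp with h | h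
      · exact absurd h (zpow_ne_zero _ (by norm_num))
      · exact h)
    rw [sin_sub_int_mul_pi]
    simp only [sin_add_int_mul_pi] at this
    linarith

theorem neg (h : IsAngleControlled τ) : IsAngleControlled fun p : X × ℝ => -τ (p.1, -p.2) where
  continuous := by have := h.continuous; fun_prop
  cos_mul_cos_pos p hp := by
    have := h.cos_mul_cos_pos (p.1, -p.2) (by simpa using hp)
    simpa using this
  sin_mul_sin_pos p hp := by
    have := h.sin_mul_sin_pos (p.1, -p.2) (by simpa using hp)
    simpa using this

variable [PreconnectedSpace X]

theorem mem_Ioo_of_mem_Icc (h : IsAngleControlled τ) {x₀ : X} (hx₀ : |τ (x₀, 0)| < π / 2)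
    {p : X × ℝ} (hp : p.2 ∈ Icc 0 π) : τ p ∈ Ioo (-(π / 2)) (3 * π / 2) := by
  have hs : IsPreconnected (τ '' (univ ×ˢ Icc 0 π)) :=
    (isPreconnected_univ.prod isPreconnected_Icc).image _ h.continuous.continuousOn
  have hmem : ∀ {q : X × ℝ}, q.2 ∈ Icc 0 π → τ q ∈ τ '' (univ ×ˢ Icc 0 π) := fun hq =>
    mem_image_of_mem _ ⟨mem_univ _, hq⟩
  have h0 := hmem (q := (x₀, 0)) ⟨le_rfl, pi_pos.le⟩
  rw [abs_lt] at hx₀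
  have h3 : 3 * π / 2 = π / 2 + π := by ring
  constructor <;> by_contra! hcon
  · obtain ⟨q, hq, hqe⟩ := hs.Icc_subset (hmem hp) h0 ⟨hcon, hx₀.1.le⟩
    have := h.sin_mul_sin_pos q (by simp [hqe])
    rw [hqe, sin_neg, sin_pi_div_two] at this
    linarith [sin_nonneg_of_nonneg_of_le_pi hq.2.1 hq.2.2]
  · obtain ⟨q, hq, hqe⟩ := hs.Icc_subset h0 (hmem hp) ⟨by linarith [pi_pos], hcon⟩
    have := h.sin_mul_sin_pos q (by rw [hqe, h3, cos_add_pi, cos_pi_div_two, neg_zero])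
    rw [hqe, h3, sin_add_pi, sin_pi_div_two] at this
    linarith [sin_nonneg_of_nonneg_of_le_pi hq.2.1 hq.2.2]

theorem abs_sub_pi_lt (h : IsAngleControlled τ) {x₀ : X} (hx₀ : |τ (x₀, 0)| < π / 2) (x : X) :
    |τ (x, π) - π| < π / 2 := by
  have h1 := h.mem_Ioo_of_mem_Icc hx₀ (p := (x, π)) ⟨pi_pos.le, le_rfl⟩
  have h2 := h.cos_mul_cos_pos (x, π) sin_pi
  simp only [cos_pi] at h2
  have h3 : ¬ 0 ≤ cos (τ (x, π)) := by linarith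
  rw [abs_lt]
  constructor
  · by_contra! hle
    exact h3 (cos_nonneg_of_mem_Icc ⟨h1.1.le, by linarith⟩)
  · linarith [h1.2]

theorem abs_sub_int_mul_pi_lt (h : IsAngleControlled τ) {x₀ : X} (hx₀ : |τ (x₀, 0)| < π / 2)
    (k : ℤ) : |τ (x₀, k * π) - k * π| < π / 2 := by
  induction k using Int.induction_on with
  | zero => simpa using hx₀
  | succ k ih =>
    have := (h.shift k).abs_sub_pi_lt (x₀ := x₀) (by simpa using ih) x₀
    push_cast at this ⊢
    convert! this using 2
    ring_nf
  | pred k ih =>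
    have := (h.shift (-k)).neg.abs_sub_pi_lt (x₀ := x₀) (by
      rw [← abs_neg]
      push_cast at ih ⊢
      convert! ih using 2
      ring_nf) x₀
    rw [← abs_neg] at this
    push_cast at this ⊢
    convert! this using 2
    ring_nf

theorem sub_int_mul_pi_mem_Ioo (h : IsAngleControlled τ) {x₀ : X} (hx₀ : |τ (x₀, 0)| < π / 2)
    (k : ℤ) {p : X × ℝ} (hp : p.2 - k * π ∈ Icc 0 π) :
    τ p - k * π ∈ Ioo (-(π / 2)) (3 * π / 2) := by
  simpa using (h.shift k).mem_Ioo_of_mem_Icc (x₀ := x₀)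
    (by simpa using h.abs_sub_int_mul_pi_lt hx₀ k) (p := (p.1, p.2 - k * π)) hp

theorem exists_int (h : IsAngleControlled τ) {x₀ : X} (hx₀ : |τ (x₀, 0)| < π / 2) (p : X × ℝ) :
    ∃ k : ℤ, k ≤ p.2 / π ∧ p.2 / π < k + 1 ∧ p.2 - k * π ∈ Ico 0 π ∧
      τ p - k * π ∈ Ioo (-(π / 2)) (3 * π / 2) := by
  have h1 := Int.floor_le (p.2 / π)
  have h2 := Int.lt_floor_add_one (p.2 / π)
  have h3 : p.2 - ⌊p.2 / π⌋ * π ∈ Ico 0 π := by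
    rw [le_div_iff₀ pi_pos] at h1
    rw [div_lt_iff₀ pi_pos] at h2
    constructor <;> linarith
  exact ⟨_, h1, h2, h3, h.sub_int_mul_pi_mem_Ioo hx₀ _ ⟨h3.1, h3.2.le⟩⟩

theorem abs_sub_le (h : IsAngleControlled τ) {x₀ : X} (hx₀ : |τ (x₀, 0)| < π / 2) (p : X × ℝ) :
    |τ p - p.2| ≤ 3 * π / 2 := by
  obtain ⟨k, -, -, h1, h2⟩ := h.exists_int hx₀ p
  rw [abs_le]
  constructor <;> linarith [h1.1, h1.2, h2.1, h2.2]

theorem pi_div_two_lt (h : IsAngleControlled τ) {x₀ : X} (hx₀ : |τ (x₀, 0)| < π / 2) {p : X × ℝ}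
    (hp : π ≤ p.2) : π / 2 < τ p := by
  obtain ⟨k, -, hk, -, h2⟩ := h.exists_int hx₀ p
  have : (0 : ℤ) < k := by
    have : (1 : ℝ) < k + 1 := ((one_le_div pi_pos).mpr hp).trans_lt hk
    exact_mod_cast (by linarith : (0 : ℝ) < k)
  have : (1 : ℝ) ≤ k := by exact_mod_cast this
  nlinarith [h2.1, pi_pos]

theorem lt_pi_div_two (h : IsAngleControlled τ) {x₀ : X} (hx₀ : |τ (x₀, 0)| < π / 2) {p : X × ℝ}
    (hp : p.2 ≤ 0) : τ p < π / 2 := by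
  have h1 : |-τ (x₀, -0)| < π / 2 := by simpa using hx₀
  obtain ⟨k, -, hk, -, h2⟩ := h.neg.exists_int h1 (p.1, -p.2)
  have : (0 : ℤ) ≤ k := by
    have : (0 : ℝ) < k + 1 := (div_nonneg (by simpa using hp) pi_pos.le).trans_lt hk
    have : (0 : ℤ) < k + 1 := by exact_mod_cast this
    omega
  have : (0 : ℝ) ≤ k := by exact_mod_cast this
  have h3 := h2.1
  simp only [neg_neg] at h3
  nlinarith [h3, pi_pos]

theorem cos_eq_zero_iff (h : IsAngleControlled τ) {x₀ : X} (hx₀ : |τ (x₀, 0)| < π / 2)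
    {p : X × ℝ} (hp : p.2 ∈ Icc 0 π) : cos (τ p) = 0 ↔ τ p = π / 2 := by
  refine ⟨fun hc => ?_, fun hc => by rw [hc, cos_pi_div_two]⟩
  have h1 := h.mem_Ioo_of_mem_Icc hx₀ hp
  rcases lt_trichotomy (τ p) (π / 2) with h2 | h2 | h2
  · linarith [cos_pos_of_mem_Ioo ⟨h1.1, h2⟩]
  · exact h2
  · linarith [cos_neg_of_pi_div_two_lt_of_lt h2 (by linarith [h1.2])]

end IsAngleControlled

end AngleControl

section Polar

open Filter Topology

/-- Polar coordinates `((y, u), t) ↦ (y, exp (u + t i))`. -/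
noncomputable def polarMap {V : Type*} (p : (V × ℝ) × ℝ) : V × ℂ :=
  (p.1.1, Complex.exp ⟨p.1.2, p.2⟩)

/-- A continuous branch of the inverse of `polarMap` on the closed upper half-plane. -/
noncomputable def polarInv {V : Type*} (p : V × ℂ) : (V × ℝ) × ℝ :=
  ((p.1, (Complex.log (-Complex.I * p.2)).re), (Complex.log (-Complex.I * p.2)).im + Real.pi / 2)

section

variable {V : Type*}

theorem polarMap_snd_ne_zero (p : (V × ℝ) × ℝ) : (polarMap p).2 ≠ 0 := Complex.exp_ne_zero _

theorem re_polarMap (p : (V × ℝ) × ℝ) :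
    (polarMap p).2.re = Real.exp p.1.2 * Real.cos p.2 := Complex.exp_re _

theorem im_polarMap (p : (V × ℝ) × ℝ) :
    (polarMap p).2.im = Real.exp p.1.2 * Real.sin p.2 := Complex.exp_im _

theorem polarMap_polarInv {p : V × ℂ} (hp : p.2 ≠ 0) : polarMap (polarInv p) = p := by
  refine Prod.ext rfl ?_
  have h : (⟨(Complex.log (-Complex.I * p.2)).re,
      (Complex.log (-Complex.I * p.2)).im + Real.pi / 2⟩ : ℂ) =
      Complex.log (-Complex.I * p.2) + Real.pi / 2 * Complex.I := by
    apply Complex.ext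
    · simp [← Complex.ofReal_ofNat, ← Complex.ofReal_div]
    · simp [← Complex.ofReal_ofNat, ← Complex.ofReal_div]
  change Complex.exp ⟨(Complex.log (-Complex.I * p.2)).re,
    (Complex.log (-Complex.I * p.2)).im + Real.pi / 2⟩ = _
  rw [h, Complex.exp_add, Complex.exp_log (mul_ne_zero (by simp) hp), Complex.exp_pi_div_two_mul_I]
  linear_combination (-p.2) * Complex.I_mul_I

theorem polarInv_polarMap {p : (V × ℝ) × ℝ} (hp : p.2 ∈ Icc 0 Real.pi) :
    polarInv (polarMap p) = p := by
  have h : -Complex.I * Complex.exp ⟨p.1.2, p.2⟩ = Complex.exp ⟨p.1.2, p.2 - Real.pi / 2⟩ := by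
    have h' : (⟨p.1.2, p.2⟩ : ℂ) = ⟨p.1.2, p.2 - Real.pi / 2⟩ + Real.pi / 2 * Complex.I := by
      apply Complex.ext
      · simp [← Complex.ofReal_ofNat, ← Complex.ofReal_div]
      · simp [← Complex.ofReal_ofNat, ← Complex.ofReal_div]
    rw [h', Complex.exp_add, Complex.exp_pi_div_two_mul_I]
    linear_combination -Complex.exp ⟨p.1.2, p.2 - Real.pi / 2⟩ * Complex.I_mul_I
  have hlog : Complex.log (-Complex.I * Complex.exp ⟨p.1.2, p.2⟩) =
      ⟨p.1.2, p.2 - Real.pi / 2⟩ := by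
    rw [h, Complex.log_exp]
    · change -Real.pi < p.2 - Real.pi / 2
      linarith [hp.1, Real.pi_pos]
    · change p.2 - Real.pi / 2 ≤ Real.pi
      linarith [hp.2, Real.pi_pos]
  simp only [polarInv, polarMap, hlog, sub_add_cancel]

theorem polarInv_snd_mem_Icc {p : V × ℂ} (hp : 0 ≤ p.2.im) :
    (polarInv p).2 ∈ Icc 0 Real.pi := by
  have h := (Complex.abs_arg_le_pi_div_two_iff (z := -Complex.I * p.2)).mpr (by simpa using hp)
  rw [abs_le] at h
  simp only [polarInv, Complex.log_im]
  constructor <;> linarith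

theorem polarInv_snd_mem_Ioo {p : V × ℂ} (hp : 0 < p.2.im) :
    (polarInv p).2 ∈ Ioo 0 Real.pi := by
  have h := (Complex.abs_arg_lt_pi_div_two_iff (z := -Complex.I * p.2)).mpr
    (Or.inl (by simpa using hp))
  rw [abs_lt] at h
  simp only [polarInv, Complex.log_im]
  constructor <;> linarith

variable [TopologicalSpace V]

theorem continuous_polarMap : Continuous (polarMap (V := V)) := by
  have : Continuous fun p : (V × ℝ) × ℝ => (⟨p.1.2, p.2⟩ : ℂ) :=
    Complex.equivRealProdCLM.symm.continuous.comp (f := fun p : (V × ℝ) × ℝ => (p.1.2, p.2))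
      (by fun_prop)
  unfold polarMap
  fun_prop

theorem comap_polarMap_nhds (y : V) :
    comap polarMap (𝓝 (y, (0 : ℂ))) = (𝓝 y ×ˢ atBot) ×ˢ ⊤ := by
  have h : comap (fun p : (V × ℝ) × ℝ => Complex.exp ⟨p.1.2, p.2⟩) (𝓝 0) =
      comap (fun p => p.1.2) atBot := by
    rw [show (fun p : (V × ℝ) × ℝ => Complex.exp ⟨p.1.2, p.2⟩) =
      Complex.exp ∘ fun p => ⟨p.1.2, p.2⟩ from rfl, ← comap_comap, Complex.comap_exp_nhds_zero,
      comap_comap]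
    rfl
  rw [nhds_prod_eq, prod_top, prod_eq_inf, prod_eq_inf, comap_inf, comap_inf, comap_comap,
    comap_comap, comap_comap, comap_comap]
  congr 1

theorem fixesEnd_of_tendsto {f : (V × ℝ) × ℝ → (V × ℝ) × ℝ}
    (hf : ∀ y, Tendsto (fun p => polarMap (f p)) ((𝓝 y ×ˢ atBot) ×ˢ ⊤) (𝓝 (y, (0 : ℂ)))) :
    FixesEnd f := by
  intro y
  nth_rw 2 [← comap_polarMap_nhds]
  exact tendsto_comap_iff.mpr (hf y)

theorem tendsto_polarMap (y : V) :
    Tendsto polarMap ((𝓝 y ×ˢ atBot) ×ˢ ⊤) (𝓝 (y, (0 : ℂ))) := by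
  rw [← comap_polarMap_nhds]
  exact tendsto_comap

theorem continuousAt_polarInv {p : V × ℂ} (hp : 0 ≤ p.2.im) (hp0 : p.2 ≠ 0) :
    ContinuousAt polarInv p := by
  have h : ContinuousAt (fun p : V × ℂ => Complex.log (-Complex.I * p.2)) p := by
    refine ContinuousAt.clog (by fun_prop) ?_
    rw [Complex.mem_slitPlane_iff]
    by_contra! h
    simp only [neg_mul, Complex.neg_re, Complex.I_mul_re, neg_neg, Complex.neg_im,
      Complex.I_mul_im, neg_eq_zero] at h
    exact hp0 (Complex.ext h.2 (le_antisymm h.1 hp))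
  exact (continuousAt_fst.prodMk (Complex.continuous_re.continuousAt.comp h)).prodMk
    ((Complex.continuous_im.continuousAt.comp h).add continuousAt_const)

end

section

variable {V : Type*} [NormedAddCommGroup V] [NormedSpace ℝ V]

theorem exists_polarMap_lift {f : (V × ℝ) × ℝ → V × ℂ} (hf : Continuous f)
    (hf0 : ∀ p, (f p).2 ≠ 0) {p₀ q₀ : (V × ℝ) × ℝ} (h : polarMap q₀ = f p₀) :
    ∃ F : (V × ℝ) × ℝ → (V × ℝ) × ℝ, Continuous F ∧ F p₀ = q₀ ∧ ∀ p, polarMap (F p) = f p := by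
  obtain ⟨ℓ, ⟨hℓ₀, hℓ⟩, -⟩ := Complex.isCoveringMapOn_exp.existsUnique_continuousMap_lifts
    ⟨fun p => (f p).2, hf.snd⟩ (a₀ := p₀) (e₀ := ⟨q₀.1.2, q₀.2⟩) (congrArg Prod.snd h) hf0
  refine ⟨fun p => (((f p).1, (ℓ p).re), (ℓ p).im), by fun_prop, ?_, fun p => ?_⟩
  · simp only [hℓ₀, ← h]
    rfl
  · exact Prod.ext rfl (congrFun hℓ p)

theorem polarMap_lift_unique {F G : (V × ℝ) × ℝ → (V × ℝ) × ℝ} (hF : Continuous F)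
    (hG : Continuous G) (h : ∀ p, polarMap (F p) = polarMap (G p)) {p₀ : (V × ℝ) × ℝ}
    (h₀ : F p₀ = G p₀) : F = G := by
  have hc : ∀ {H : (V × ℝ) × ℝ → (V × ℝ) × ℝ}, Continuous H →
      Continuous fun p => (⟨(H p).1.2, (H p).2⟩ : ℂ) := fun hH =>
    Complex.equivRealProdCLM.symm.continuous.comp (hH.fst.snd.prodMk hH.snd)
  have hu := Complex.isCoveringMapOn_exp.existsUnique_continuousMap_lifts
    ⟨fun p => (polarMap (F p)).2, (continuous_polarMap.comp hF).snd⟩ (a₀ := p₀)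
    (e₀ := ⟨(F p₀).1.2, (F p₀).2⟩) rfl fun p => polarMap_snd_ne_zero _
  have heq := hu.unique (y₁ := ⟨_, hc hF⟩) (y₂ := ⟨_, hc hG⟩) ⟨rfl, rfl⟩
    ⟨by simp [h₀], funext fun p => (congrArg Prod.snd (h p)).symm⟩
  funext p
  have hp := DFunLike.congr_fun heq p
  have h1 : (F p).1.1 = (G p).1.1 := (Prod.ext_iff.mp (h p)).1
  exact Prod.ext (Prod.ext h1 (congrArg Complex.re hp)) (congrArg Complex.im hp)

theorem exists_homeomorph_polarMap_lift (h : (V × ℂ) ≃ₜ (V × ℂ)) (h0 : ∀ y, h (y, 0) = (y, 0))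
    {p₀ q₀ : (V × ℝ) × ℝ} (hq : polarMap q₀ = h (polarMap p₀)) :
    ∃ g : ((V × ℝ) × ℝ) ≃ₜ ((V × ℝ) × ℝ), g p₀ = q₀ ∧ (∀ p, polarMap (g p) = h (polarMap p)) ∧
      FixesEnd g ∧ FixesEnd g.symm := by
  have key : ∀ k : (V × ℂ) ≃ₜ (V × ℂ), (∀ y, k (y, 0) = (y, 0)) → ∀ p, p.2 ≠ 0 → (k p).2 ≠ 0 := by
    intro k hk p hp hkp
    have h1 : k ((k p).1, 0) = k p := by rw [hk, ← hkp]
    exact hp (by rw [← k.injective h1])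
  have h0' : ∀ y, h.symm (y, 0) = (y, 0) := fun y => by rw [← h0 y, h.symm_apply_apply, h0]
  have fe : ∀ k : (V × ℂ) ≃ₜ (V × ℂ), (∀ y, k (y, 0) = (y, 0)) →
      ∀ F : (V × ℝ) × ℝ → (V × ℝ) × ℝ, (∀ p, polarMap (F p) = k (polarMap p)) → FixesEnd F := by
    intro k hk F hF
    refine fixesEnd_of_tendsto fun y => ?_
    simp_rw [hF]
    have h1 := (k.continuous.tendsto (y, 0)).comp (tendsto_polarMap y)
    rwa [hk] at h1
  obtain ⟨F, hFc, hF₀, hF⟩ := exists_polarMap_lift (h.continuous.comp continuous_polarMap)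
    (fun p => key h h0 _ (polarMap_snd_ne_zero p)) hq
  obtain ⟨G, hGc, hG₀, hG⟩ := exists_polarMap_lift (h.symm.continuous.comp continuous_polarMap)
    (fun p => key h.symm h0' _ (polarMap_snd_ne_zero p)) (p₀ := q₀) (q₀ := p₀)
    (by rw [Function.comp_apply, hq, h.symm_apply_apply])
  have hGF : G ∘ F = id := polarMap_lift_unique (hGc.comp hFc) continuous_id
    (fun p => by simp [hG, hF]) (p₀ := p₀) (by simp [hF₀, hG₀])
  have hFG : F ∘ G = id := polarMap_lift_unique (hFc.comp hGc) continuous_id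
    (fun p => by simp [hG, hF]) (p₀ := q₀) (by simp [hF₀, hG₀])
  exact ⟨⟨⟨F, G, congrFun hGF, congrFun hFG⟩, hFc, hGc⟩, hF₀, hF, fe h h0 F hF,
    fe h.symm h0' G hG⟩

end

end Polar

section HalfMap

open Filter Topology

/-- The self-map of `V × ℂ` which is the identity on the closed lower half-space and is given by
`K` in polar coordinates on the upper half-space. -/
noncomputable def halfMap {V : Type*} (K : (V × ℝ) × ℝ → (V × ℝ) × ℝ) (p : V × ℂ) : V × ℂ :=
  open scoped Classical in if p.2.im ≤ 0 then p else polarMap (K (polarInv p))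

variable {V : Type*}

theorem halfMap_of_im_nonpos (K : (V × ℝ) × ℝ → (V × ℝ) × ℝ) {p : V × ℂ} (hp : p.2.im ≤ 0) :
    halfMap K p = p := if_pos hp

theorem halfMap_of_im_pos (K : (V × ℝ) × ℝ → (V × ℝ) × ℝ) {p : V × ℂ} (hp : 0 < p.2.im) :
    halfMap K p = polarMap (K (polarInv p)) := if_neg hp.not_ge

theorem snd_ne_zero_of_im_pos {p : V × ℂ} (hp : 0 < p.2.im) : p.2 ≠ 0 := fun h => by
  simp [h] at hp

theorem im_polarMap_pos {p : (V × ℝ) × ℝ} (hp : p.2 ∈ Ioo 0 Real.pi) :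
    0 < (polarMap p).2.im := by
  rw [im_polarMap]
  exact mul_pos (Real.exp_pos _) (Real.sin_pos_of_mem_Ioo hp)

theorem halfMap_halfMap {K L : (V × ℝ) × ℝ → (V × ℝ) × ℝ} (hLK : ∀ p, L (K p) = p)
    (hK : ∀ p, p.2 ∈ Ioo 0 Real.pi → (K p).2 ∈ Ioo 0 Real.pi) (p : V × ℂ) :
    halfMap L (halfMap K p) = p := by
  by_cases hp : p.2.im ≤ 0
  · rw [halfMap_of_im_nonpos K hp, halfMap_of_im_nonpos L hp]
  · push Not at hp
    have h1 := hK _ (polarInv_snd_mem_Ioo hp)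
    rw [halfMap_of_im_pos K hp, halfMap_of_im_pos L (im_polarMap_pos h1),
      polarInv_polarMap (Ioo_subset_Icc_self h1), hLK,
      polarMap_polarInv (snd_ne_zero_of_im_pos hp)]

variable [TopologicalSpace V]

theorem Homeomorph.snd_mem_Ioo_of_eq_id (K : ((V × ℝ) × ℝ) ≃ₜ ((V × ℝ) × ℝ)) {a b : ℝ}
    (ha : ∀ p, p.2 ≤ a → K p = p) (hb : ∀ p, b ≤ p.2 → K p = p) {p : (V × ℝ) × ℝ}
    (hp : p.2 ∈ Ioo a b) : (K p).2 ∈ Ioo a b := by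
  constructor <;> by_contra! h
  · have := K.injective (ha _ h)
    rw [this] at h
    exact hp.1.not_ge h
  · have := K.injective (hb _ h)
    rw [this] at h
    exact hp.2.not_ge h

theorem continuous_halfMap {K : (V × ℝ) × ℝ → (V × ℝ) × ℝ} (hKc : Continuous K)
    (hK : FixesEnd K) (ha : ∀ p, p.2 = 0 → K p = p) (hb : ∀ p, p.2 = Real.pi → K p = p) :
    Continuous (halfMap K) := by
  have hbd : ∀ p : V × ℂ, p.2.im = 0 → p.2 ≠ 0 → polarMap (K (polarInv p)) = p := by
    intro p hp hp0
    have h1 : (polarMap (polarInv p)).2.im = 0 := by rw [polarMap_polarInv hp0, hp]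
    have h2 := polarInv_snd_mem_Icc hp.ge
    rw [im_polarMap, mul_eq_zero, or_iff_right (Real.exp_pos _).ne'] at h1
    have h3 : (polarInv p).2 = 0 ∨ (polarInv p).2 = Real.pi := by
      by_contra! h
      exact (Real.sin_pos_of_mem_Ioo ⟨h2.1.lt_of_ne' h.1, h2.2.lt_of_ne h.2⟩).ne' h1
    rw [h3.elim (ha _) (hb _), polarMap_polarInv hp0]
  have hup : ∀ p : V × ℂ, 0 ≤ p.2.im → p.2 ≠ 0 → halfMap K p = polarMap (K (polarInv p)) := by
    intro p hp hp0
    rcases hp.eq_or_lt with h | h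
    · rw [halfMap_of_im_nonpos _ h.ge, hbd p h.symm hp0]
    · exact halfMap_of_im_pos _ h
  have himc : Continuous fun p : V × ℂ => p.2.im := by fun_prop
  have hlow : ContinuousOn (halfMap K) {p | p.2.im ≤ 0} :=
    continuousOn_id.congr fun p hp => halfMap_of_im_nonpos _ hp
  have hhigh : ContinuousOn (halfMap K) {p | 0 ≤ p.2.im} := by
    intro p hp
    by_cases hp0 : p.2 = 0
    · obtain ⟨y, z⟩ := p
      obtain rfl : z = 0 := hp0
      have hinv : Tendsto polarInv (𝓝[{p | p.2 ≠ 0}] (y, (0 : ℂ))) ((𝓝 y ×ˢ atBot) ×ˢ ⊤) := by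
        rw [← comap_polarMap_nhds, tendsto_comap_iff]
        refine (tendsto_id.mono_left nhdsWithin_le_nhds).congr' ?_
        filter_upwards [self_mem_nhdsWithin] with q hq using (polarMap_polarInv hq).symm
      have h1 := (tendsto_polarMap y).comp ((hK y).comp hinv)
      rw [ContinuousWithinAt, halfMap_of_im_nonpos _ (by simp)]
      intro W hW
      have h2 := h1 hW
      rw [mem_map, mem_nhdsWithin_iff_eventually] at h2
      rw [mem_map, mem_nhdsWithin_iff_eventually]
      filter_upwards [h2, hW] with q hq hqW hq'
      by_cases hq0 : q.2 = 0
      · rw [mem_preimage, halfMap_of_im_nonpos _ (by simp [hq0])]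
        exact hqW
      · rw [mem_preimage, hup q hq' hq0]
        exact hq hq0
    · have h1 : ContinuousAt (fun p => polarMap (K (polarInv p))) p :=
        (continuous_polarMap.comp hKc).continuousAt.comp (continuousAt_polarInv hp hp0)
      refine h1.continuousWithinAt.congr_of_eventuallyEq ?_ (hup p hp hp0)
      have h2 : ∀ᶠ q : V × ℂ in 𝓝 p, q.2 ≠ 0 := continuous_snd.continuousAt.eventually_ne hp0
      filter_upwards [nhdsWithin_le_nhds h2, self_mem_nhdsWithin] with q hq hq' using hup q hq' hq
  rw [← continuousOn_univ, ← show {p : V × ℂ | p.2.im ≤ 0} ∪ {p | 0 ≤ p.2.im} = univ from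
    eq_univ_of_forall fun p => le_total p.2.im 0]
  exact hlow.union_of_isClosed hhigh (isClosed_le himc continuous_const)
    (isClosed_le continuous_const himc)

end HalfMap

section Straighten

open Filter Topology

variable {V : Type*} [NormedAddCommGroup V] [NormedSpace ℝ V] [ProperSpace V]

theorem exists_homeomorph_straighten_half (h : (V × ℂ) ≃ₜ (V × ℂ)) (h0 : ∀ y, h (y, 0) = (y, 0))
    (hre : ∀ p : V × ℂ, p.2 ≠ 0 → p.2.im = 0 → 0 < p.2.re * (h p).2.re)
    (him : ∀ p : V × ℂ, p.2 ≠ 0 → (h p).2.re = 0 → 0 < p.2.im * (h p).2.im) :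
    ∃ N : (V × ℂ) ≃ₜ (V × ℂ), (∀ p, p.2.im ≤ 0 → N p = p) ∧
      ∀ p, 0 < p.2.im → 0 < (N p).2.im ∧ ((N p).2.re = 0 ↔ (h p).2.re = 0) := by
  have hp₀ : polarMap (((0 : V), 0), 0) = (0, 1) :=
    Prod.ext rfl (Complex.ext (by simp [re_polarMap]) (by simp [im_polarMap]))
  have hbase : 0 < (h (0, 1)).2.re := by simpa using hre (0, 1) (by simp) (by simp)
  have hbase0 : (h (0, 1)).2 ≠ 0 := fun h' => by simp [h'] at hbase
  obtain ⟨g, hg₀, hg, hge, hge'⟩ := exists_homeomorph_polarMap_lift h h0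
    (p₀ := (((0 : V), 0), 0))
    (q₀ := (((h (0, 1)).1, (Complex.log (h (0, 1)).2).re), (Complex.log (h (0, 1)).2).im))
    (by rw [hp₀]; exact Prod.ext rfl (Complex.exp_log hbase0))
  have hx₀ : |(g (((0 : V), 0), 0)).2| < Real.pi / 2 := by
    rw [hg₀]
    simpa only [Complex.log_im] using Complex.abs_arg_lt_pi_div_two_iff.mpr (Or.inl hbase)
  have hctrl : IsAngleControlled fun p : (V × ℝ) × ℝ => (g p).2 := by
    refine ⟨g.continuous.snd, fun p hp => ?_, fun p hp => ?_⟩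
    · have h1 := hre (polarMap p) (polarMap_snd_ne_zero p) (by rw [im_polarMap, hp, mul_zero])
      rw [← hg, re_polarMap, re_polarMap, mul_mul_mul_comm] at h1
      exact (pos_iff_pos_of_mul_pos h1).mp (by positivity)
    · have h1 := him (polarMap p) (polarMap_snd_ne_zero p)
        (by rw [← hg, re_polarMap, hp, mul_zero])
      rw [← hg, im_polarMap, im_polarMap, mul_mul_mul_comm] at h1
      exact (pos_iff_pos_of_mul_pos h1).mp (by positivity)
  have hpi := Real.pi_pos
  obtain ⟨M, hM, hM', hMa, hMb, hMm⟩ := exists_homeomorph_interpolate g hge hge'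
    (fun p => hctrl.abs_sub_le hx₀ p) (a := 0) (b := Real.pi / 2) (c := Real.pi) (by linarith)
    (by linarith) (fun p hp => hctrl.pi_div_two_lt hx₀ hp) fun p hp => hctrl.lt_pi_div_two hx₀ hp
  have hMa' : ∀ p, p.2 ≤ 0 → M.symm p = p := fun p hp => by
    rw [M.symm_apply_eq, hMa p hp]
  have hMb' : ∀ p, Real.pi ≤ p.2 → M.symm p = p := fun p hp => by
    rw [M.symm_apply_eq, hMb p hp]
  have hIoo := fun p => M.snd_mem_Ioo_of_eq_id hMa hMb (p := p)
  have hIoo' := fun p => M.symm.snd_mem_Ioo_of_eq_id hMa' hMb' (p := p)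
  refine ⟨⟨⟨halfMap M.symm, halfMap M, halfMap_halfMap M.apply_symm_apply hIoo',
    halfMap_halfMap M.symm_apply_apply hIoo⟩,
    continuous_halfMap M.symm.continuous hM' (fun p hp => hMa' p hp.le) (fun p hp => hMb' p hp.ge),
    continuous_halfMap M.continuous hM (fun p hp => hMa p hp.le) (fun p hp => hMb p hp.ge)⟩,
    fun p hp => halfMap_of_im_nonpos _ hp, fun p hp => ?_⟩
  change 0 < (halfMap M.symm p).2.im ∧ ((halfMap M.symm p).2.re = 0 ↔ _)
  have hq := polarInv_snd_mem_Ioo hp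
  rw [halfMap_of_im_pos _ hp, ← polarMap_polarInv (snd_ne_zero_of_im_pos hp)]
  generalize polarInv p = q at hq ⊢
  rw [polarInv_polarMap (Ioo_subset_Icc_self hq)]
  refine ⟨im_polarMap_pos (hIoo' _ hq), ?_⟩
  rw [← hg, re_polarMap, re_polarMap, mul_eq_zero, mul_eq_zero,
    or_iff_right (Real.exp_pos _).ne', or_iff_right (Real.exp_pos _).ne',
    hctrl.cos_eq_zero_iff hx₀ (Ioo_subset_Icc_self hq)]
  constructor
  · intro hc
    have h1 := hIoo' _ hq
    have h2 : (M.symm q).2 = Real.pi / 2 := by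
      rw [← Real.cos_pi_div_two] at hc
      exact Real.injOn_cos (Ioo_subset_Icc_self h1) ⟨by linarith, by linarith⟩ hc
    have h3 := hMm _ h2
    rw [M.apply_symm_apply] at h3
    rw [h3, g.apply_symm_apply, h2]
  · intro hc
    have h3 := hMm _ hc
    rw [g.symm_apply_apply, ← M.eq_symm_apply] at h3
    rw [← h3, hc, Real.cos_pi_div_two]

end Straighten

section Crossing

open Filter Topology

/-- The homeomorphism of `V × ℂ` multiplying the real part by `ε` and the imaginary part by `δ`,
where `ε` and `δ` are signs. -/
def flipHomeomorph (V : Type*) [TopologicalSpace V] {ε δ : ℝ} (hε : ε * ε = 1) (hδ : δ * δ = 1) :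
    (V × ℂ) ≃ₜ (V × ℂ) where
  toFun p := (p.1, ⟨ε * p.2.re, δ * p.2.im⟩)
  invFun p := (p.1, ⟨ε * p.2.re, δ * p.2.im⟩)
  left_inv p := by simp [← mul_assoc, hε, hδ]
  right_inv p := by simp [← mul_assoc, hε, hδ]
  continuous_toFun := continuous_fst.prodMk <| Complex.equivRealProdCLM.symm.continuous.comp
    (f := fun p : V × ℂ => (ε * p.2.re, δ * p.2.im)) (by fun_prop)
  continuous_invFun := continuous_fst.prodMk <| Complex.equivRealProdCLM.symm.continuous.comp
    (f := fun p : V × ℂ => (ε * p.2.re, δ * p.2.im)) (by fun_prop)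

section

variable {V : Type*} [NormedAddCommGroup V] [NormedSpace ℝ V] [ProperSpace V]

theorem exists_homeomorph_straighten (h : (V × ℂ) ≃ₜ (V × ℂ)) (h0 : ∀ y, h (y, 0) = (y, 0))
    (hre : ∀ p : V × ℂ, p.2 ≠ 0 → p.2.im = 0 → 0 < p.2.re * (h p).2.re)
    (him : ∀ p : V × ℂ, p.2 ≠ 0 → (h p).2.re = 0 → 0 < p.2.im * (h p).2.im) :
    ∃ N : (V × ℂ) ≃ₜ (V × ℂ), ∀ p,
      ((N p).2.im = 0 ↔ p.2.im = 0) ∧ ((N p).2.re = 0 ↔ (h p).2.re = 0) := by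
  obtain ⟨N₁, hN₁, hN₁'⟩ := exists_homeomorph_straighten_half h h0 hre him
  let c : (V × ℂ) ≃ₜ (V × ℂ) := flipHomeomorph V (ε := 1) (δ := -1) (by norm_num) (by norm_num)
  have hc1 : ∀ p, (c p).2.re = p.2.re := fun p => one_mul _
  have hc2 : ∀ p, (c p).2.im = -p.2.im := fun p => neg_one_mul _
  have hc0 : ∀ y, c (y, 0) = (y, 0) := fun y =>
    Prod.ext rfl (Complex.ext (by simp [hc1]) (by simp [hc2]))
  have hcne : ∀ p, p.2 ≠ 0 → (c p).2 ≠ 0 := fun p hp hcp =>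
    hp (Complex.ext (by rw [← hc1, hcp]) (by rw [← neg_neg p.2.im, ← hc2, hcp]; simp))
  have hcc : ∀ p, c (c p) = p := fun p => c.left_inv p
  obtain ⟨N₂, hN₂, hN₂'⟩ := exists_homeomorph_straighten_half ((c.trans h).trans c)
    (fun y => by simp [hc0, h0])
    (fun p hp hp' => by
      have := hre (c p) (hcne p hp) (by rw [hc2, hp', neg_zero])
      simpa [hc1] using this)
    (fun p hp hp' => by
      have := him (c p) (hcne p hp) (by simpa [hc1] using hp')
      simpa [hc2] using this)
  refine ⟨N₁.trans ((c.trans N₂).trans c), fun p => ?_⟩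
  simp only [Homeomorph.trans_apply, hc1, hc2, neg_eq_zero]
  rcases lt_trichotomy p.2.im 0 with hp | hp | hp
  · rw [hN₁ p hp.le]
    obtain ⟨h1, h2⟩ := hN₂' (c p) (by rw [hc2]; linarith)
    simp only [Homeomorph.trans_apply, hc1, hcc] at h2
    exact ⟨by simp [h1.ne', hp.ne], h2⟩
  · rw [hN₁ p hp.le, hN₂ (c p) (by rw [hc2, hp, neg_zero]), hc1, hc2]
    refine ⟨neg_eq_zero, ?_⟩
    by_cases hp0 : p.2 = 0
    · obtain ⟨y, z⟩ := p
      obtain rfl : z = 0 := hp0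
      rw [h0]
    · have := hre p hp0 hp
      constructor <;> intro h' <;> simp [h'] at this
  · obtain ⟨h1, h2⟩ := hN₁' p hp
    rw [hN₂ _ (by rw [hc2]; linarith), hc1, hc2]
    exact ⟨by simp [h1.ne', hp.ne'], h2⟩

end

theorem IsPreconnected.forall_pos_or_forall_neg {X : Type*} [TopologicalSpace X] {s : Set X}
    (hs : IsPreconnected s) {f : X → ℝ} (hf : ContinuousOn f s) (h0 : ∀ x ∈ s, f x ≠ 0) :
    (∀ x ∈ s, 0 < f x) ∨ ∀ x ∈ s, f x < 0 := by
  by_contra! h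
  obtain ⟨⟨x, hx, hfx⟩, y, hy, hfy⟩ := h
  obtain ⟨z, hz, hz0⟩ := hs.intermediate_value hx hy hf ⟨hfx, hfy⟩
  exact h0 z hz hz0

theorem exists_sign {Y : Type*} [TopologicalSpace Y] [PreconnectedSpace Y] {f : Y × ℝ → ℝ}
    (hf : Continuous f) (h0 : ∀ p, f p = 0 ↔ p.2 = 0) (hpos : ∃ p, 0 < f p)
    (hneg : ∃ p, f p < 0) : ∃ ε : ℝ, ε * ε = 1 ∧ ∀ p, p.2 ≠ 0 → 0 < ε * (p.2 * f p) := by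
  have h1 := (isPreconnected_univ.prod (isPreconnected_Ioi (a := (0 : ℝ)))).forall_pos_or_forall_neg
    hf.continuousOn fun p hp => (h0 p).not.mpr (ne_of_gt hp.2)
  have h2 := (isPreconnected_univ.prod (isPreconnected_Iio (a := (0 : ℝ)))).forall_pos_or_forall_neg
    hf.continuousOn fun p hp => (h0 p).not.mpr (ne_of_lt hp.2)
  simp only [mem_prod, mem_univ, true_and, mem_Ioi, mem_Iio] at h1 h2
  obtain ⟨p, hp⟩ := hpos
  obtain ⟨q, hq⟩ := hneg
  have hp0 : p.2 ≠ 0 := (h0 p).not.mp hp.ne'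
  have hq0 : q.2 ≠ 0 := (h0 q).not.mp hq.ne
  rcases h1 with h1 | h1 <;> rcases h2 with h2 | h2
  · rcases hq0.lt_or_gt with h | h
    · exact absurd (h2 q h) hq.not_gt
    · exact absurd (h1 q h) hq.not_gt
  · refine ⟨1, by norm_num, fun r hr => ?_⟩
    rw [one_mul]
    rcases hr.lt_or_gt with h | h
    · exact mul_pos_of_neg_of_neg h (h2 r h)
    · exact mul_pos h (h1 r h)
  · refine ⟨-1, by norm_num, fun r hr => ?_⟩
    rw [neg_one_mul, neg_pos]
    rcases hr.lt_or_gt with h | h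
    · exact mul_neg_of_neg_of_pos h (h2 r h)
    · exact mul_neg_of_pos_of_neg h (h1 r h)
  · rcases hp0.lt_or_gt with h | h
    · exact absurd (h2 p h) hp.not_gt
    · exact absurd (h1 p h) hp.not_gt

theorem continuous_complex_mk : Continuous fun p : ℝ × ℝ => (⟨p.1, p.2⟩ : ℂ) :=
  Complex.equivRealProdCLM.symm.continuous

theorem exists_homeomorph_forall_im_re {X V : Type*} [TopologicalSpace X] [NormedAddCommGroup V]
    [NormedSpace ℝ V] [ProperSpace V] (e₁ e₂ : X ≃ₜ V × ℂ)
    (h₁ : ∀ x, (e₁ x).2 = 0 ↔ (e₁ x).2.im = 0 ∧ (e₂ x).2.re = 0)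
    (h₂ : ∀ x, (e₂ x).2 = 0 ↔ (e₁ x).2.im = 0 ∧ (e₂ x).2.re = 0)
    (him : (∃ x, (e₂ x).2.re = 0 ∧ 0 < (e₁ x).2.im) ∧ ∃ x, (e₂ x).2.re = 0 ∧ (e₁ x).2.im < 0)
    (hre : (∃ x, (e₁ x).2.im = 0 ∧ 0 < (e₂ x).2.re) ∧ ∃ x, (e₁ x).2.im = 0 ∧ (e₂ x).2.re < 0) :
    ∃ N : X ≃ₜ V × ℂ, ∀ x,
      ((N x).2.im = 0 ↔ (e₁ x).2.im = 0) ∧ ((N x).2.re = 0 ↔ (e₂ x).2.re = 0) := by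
  obtain ⟨δ, hδ, hδ'⟩ : ∃ δ : ℝ, δ * δ = 1 ∧
      ∀ x, (e₂ x).2.re = 0 → (e₂ x).2 ≠ 0 → 0 < δ * ((e₂ x).2.im * (e₁ x).2.im) := by
    have key : ∀ x, (e₂ x).2.re = 0 → e₂.symm ((e₂ x).1, ⟨0, (e₂ x).2.im⟩) = x := fun x hx => by
      rw [← hx]; exact e₂.symm_apply_apply x
    obtain ⟨δ, hδ, hδ'⟩ := exists_sign
      (f := fun p : V × ℝ => (e₁ (e₂.symm (p.1, ⟨0, p.2⟩))).2.im)
      (Complex.continuous_im.comp <| continuous_snd.comp <| e₁.continuous.comp <|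
        e₂.symm.continuous.comp <| continuous_fst.prodMk <|
        continuous_complex_mk.comp (continuous_const.prodMk continuous_snd))
      (fun p => by
        have := h₂ (e₂.symm (p.1, ⟨0, p.2⟩))
        rw [e₂.apply_symm_apply] at this
        simpa [Complex.ext_iff] using this.symm)
      (by
        obtain ⟨x, hx, hx'⟩ := him.1
        exact ⟨((e₂ x).1, (e₂ x).2.im), by simpa only [key x hx]⟩)
      (by
        obtain ⟨x, hx, hx'⟩ := him.2
        exact ⟨((e₂ x).1, (e₂ x).2.im), by simpa only [key x hx]⟩)
    refine ⟨δ, hδ, fun x hx hx0 => ?_⟩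
    have := hδ' ((e₂ x).1, (e₂ x).2.im) (fun h => hx0 (Complex.ext hx h))
    simpa only [key x hx] using this
  obtain ⟨ε, hε, hε'⟩ : ∃ ε : ℝ, ε * ε = 1 ∧
      ∀ x, (e₁ x).2.im = 0 → (e₁ x).2 ≠ 0 → 0 < ε * ((e₁ x).2.re * (e₂ x).2.re) := by
    have key : ∀ x, (e₁ x).2.im = 0 → e₁.symm ((e₁ x).1, ⟨(e₁ x).2.re, 0⟩) = x := fun x hx => by
      rw [← hx]; exact e₁.symm_apply_apply x
    obtain ⟨ε, hε, hε'⟩ := exists_sign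
      (f := fun p : V × ℝ => (e₂ (e₁.symm (p.1, ⟨p.2, 0⟩))).2.re)
      (Complex.continuous_re.comp <| continuous_snd.comp <| e₂.continuous.comp <|
        e₁.symm.continuous.comp <| continuous_fst.prodMk <|
        continuous_complex_mk.comp (continuous_snd.prodMk continuous_const))
      (fun p => by
        have := h₁ (e₁.symm (p.1, ⟨p.2, 0⟩))
        rw [e₁.apply_symm_apply] at this
        simpa [Complex.ext_iff] using this.symm)
      (by
        obtain ⟨x, hx, hx'⟩ := hre.1
        exact ⟨((e₁ x).1, (e₁ x).2.re), by simpa only [key x hx]⟩)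
      (by
        obtain ⟨x, hx, hx'⟩ := hre.2
        exact ⟨((e₁ x).1, (e₁ x).2.re), by simpa only [key x hx]⟩)
    refine ⟨ε, hε, fun x hx hx0 => ?_⟩
    have := hε' ((e₁ x).1, (e₁ x).2.re) (fun h => hx0 (Complex.ext h hx))
    simpa only [key x hx] using this
  have h12 : ∀ x, (e₁ x).2 = 0 ↔ (e₂ x).2 = 0 := fun x => (h₁ x).trans (h₂ x).symm
  have hf₁ : ∀ x, (e₂ x).2 = 0 → e₁.symm ((e₁ x).1, 0) = x := fun x hx => by
    rw [← (h12 x).mpr hx]; exact e₁.symm_apply_apply x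
  have hf₂ : ∀ x, (e₁ x).2 = 0 → e₂.symm ((e₂ x).1, 0) = x := fun x hx => by
    rw [← (h12 x).mp hx]; exact e₂.symm_apply_apply x
  let g : V ≃ₜ V :=
    { toFun := fun y => (e₁ (e₂.symm (y, 0))).1
      invFun := fun y => (e₂ (e₁.symm (y, 0))).1
      left_inv := fun y => by simp [hf₁]
      right_inv := fun y => by simp [hf₂]
      continuous_toFun := by fun_prop
      continuous_invFun := by fun_prop }
  let k : (V × ℂ) ≃ₜ (V × ℂ) :=
    (g.prodCongr (Homeomorph.refl ℂ)).trans (flipHomeomorph V hε hδ)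
  have hk1 : ∀ p, (k p).2.re = ε * p.2.re := fun p => rfl
  have hk2 : ∀ p, (k p).2.im = δ * p.2.im := fun p => rfl
  obtain ⟨N, hN⟩ := exists_homeomorph_straighten ((e₁.symm.trans e₂).trans k)
    (fun y => by
      have hy : (e₂ (e₁.symm (y, 0))).2 = 0 := by rw [← h12, e₁.apply_symm_apply]
      simp only [Homeomorph.trans_apply]
      refine Prod.ext ?_ (Complex.ext ?_ ?_)
      · exact g.apply_symm_apply y
      · rw [hk1, hy]; simp
      · rw [hk2, hy]; simp)
    (fun p hp hp' => by
      have := hε' (e₁.symm p) (by simpa using hp') (by simpa using hp)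
      simp only [Homeomorph.trans_apply, hk1]
      rw [e₁.apply_symm_apply] at this
      linarith)
    (fun p hp hp' => by
      simp only [Homeomorph.trans_apply, hk1] at hp'
      have hε0 : ε ≠ 0 := fun h => by simp [h] at hε
      have := hδ' (e₁.symm p) ((mul_eq_zero.mp hp').resolve_left hε0)
        (by rw [Ne, ← h12]; simpa using hp)
      simp only [Homeomorph.trans_apply, hk2]
      rw [e₁.apply_symm_apply] at this
      linarith)
  refine ⟨e₁.trans N, fun x => ?_⟩
  have hε0 : ε ≠ 0 := fun h => by simp [h] at hε
  have := hN (e₁ x)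
  simp only [Homeomorph.trans_apply, e₁.symm_apply_apply, hk1, mul_eq_zero, hε0, false_or] at this
  exact this

end Crossing

section Charts

open Filter Topology

theorem coordHyp_of_lt {n i : ℕ} (h : i < n) : coordHyp n i = {x | x ⟨i, h⟩ = 0} :=
  Set.ext fun _ => ⟨fun hx => hx h, fun hx _ => hx⟩

/-- Splitting off the first coordinate of `ℝᵏ⁺¹`. -/
noncomputable def splitFirst (k : ℕ) : (Fin (k + 1) → ℝ) ≃ₜ ℝ × (Fin k → ℝ) :=
  (Fin.consEquivL ℝ fun _ : Fin (k + 1) => ℝ).symm.toHomeomorph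

theorem IsTopoplane.exists_homeomorph {k : ℕ} {H : Set (Fin (k + 1) → ℝ)} (hH : IsTopoplane H) :
    ∃ e : (Fin (k + 1) → ℝ) ≃ₜ ℝ × (Fin k → ℝ), ∀ x, x ∈ H ↔ (e x).1 = 0 := by
  obtain ⟨e, he⟩ := hH
  refine ⟨e.trans (splitFirst k), fun x => ?_⟩
  rw [← e.injective.mem_set_image, he, coordHyp_of_lt k.succ_pos]
  rfl

theorem IsRelTopoplane.exists_homeomorph {n : ℕ} {Y Z : Set (Fin n → ℝ)}
    (h : IsRelTopoplane Y Z) :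
    ∃ (m : ℕ) (φ : Y ≃ₜ ℝ × (Fin m → ℝ)), ∀ y : Y, (y : Fin n → ℝ) ∈ Z ↔ (φ y).1 = 0 := by
  obtain ⟨-, d, hd, φ, hφ⟩ := h
  obtain ⟨m, rfl⟩ := Nat.exists_eq_add_of_le' hd
  refine ⟨m, φ.trans (splitFirst m), fun y => ?_⟩
  have h1 : (y : Fin n → ℝ) ∈ Z ↔ φ y ∈ φ '' {y : Y | (y : Fin n → ℝ) ∈ Z} :=
    (φ.injective.mem_set_image (s := {y : Y | (y : Fin n → ℝ) ∈ Z})).symm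
  rw [h1, hφ, coordHyp_of_lt m.succ_pos]
  rfl

/-- The homeomorphism exchanging `ℝ × ℝ × V` and `V × ℂ`, the first factor becoming the
imaginary part and the second one the real part. -/
def prodComplexHomeomorph (V : Type*) [TopologicalSpace V] : (ℝ × ℝ × V) ≃ₜ V × ℂ where
  toFun p := (p.2.2, ⟨p.2.1, p.1⟩)
  invFun p := (p.2.im, p.2.re, p.1)
  left_inv _ := rfl
  right_inv _ := rfl
  continuous_toFun := continuous_snd.snd.prodMk <| continuous_complex_mk.comp
    (f := fun p : ℝ × ℝ × V => (p.2.1, p.1)) (by fun_prop)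
  continuous_invFun := by fun_prop

/-- The homeomorphism exchanging `ℝ × ℝ × V` and `V × ℂ`, the first factor becoming the
real part and the second one the imaginary part. -/
def prodComplexHomeomorphSwap (V : Type*) [TopologicalSpace V] : (ℝ × ℝ × V) ≃ₜ V × ℂ where
  toFun p := (p.2.2, ⟨p.1, p.2.1⟩)
  invFun p := (p.2.re, p.2.im, p.1)
  left_inv _ := rfl
  right_inv _ := rfl
  continuous_toFun := continuous_snd.snd.prodMk <| continuous_complex_mk.comp
    (f := fun p : ℝ × ℝ × V => (p.1, p.2.1)) (by fun_prop)
  continuous_invFun := by fun_prop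

theorem IsTopoplane.exists_chart {k : ℕ} {H Z : Set (Fin (k + 1) → ℝ)} (hH : IsTopoplane H)
    (hZ : IsRelTopoplane H Z) :
    ∃ m, k = m + 1 ∧ ∃ e : (Fin (k + 1) → ℝ) ≃ₜ ℝ × ℝ × (Fin m → ℝ),
      (∀ x, x ∈ H ↔ (e x).1 = 0) ∧ ∀ x, x ∈ Z ↔ (e x).1 = 0 ∧ (e x).2.1 = 0 := by
  obtain ⟨e, he⟩ := hH.exists_homeomorph
  obtain ⟨m, φ, hφ⟩ := hZ.exists_homeomorph
  let σ : (Fin k → ℝ) ≃ₜ H :=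
    { toFun := fun v => ⟨e.symm (0, v), by rw [he, e.apply_symm_apply]⟩
      invFun := fun x => (e x).2
      left_inv := fun v => by simp
      right_inv := fun x => Subtype.ext <| by
        change e.symm (0, (e x).2) = x
        rw [← (he x).mp x.2]
        exact e.symm_apply_apply _
      continuous_toFun := by fun_prop
      continuous_invFun := by fun_prop }
  have hσ : ∀ x (hx : x ∈ H), σ (e x).2 = ⟨x, hx⟩ := fun x hx => σ.apply_symm_apply ⟨x, hx⟩
  let ψ := σ.trans φ
  refine ⟨m, eq_of_homeomorph_pi (ψ.trans (splitFirst m).symm),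
    e.trans ((Homeomorph.refl ℝ).prodCongr ψ), he, fun x => ?_⟩
  change x ∈ Z ↔ (e x).1 = 0 ∧ (φ (σ (e x).2)).1 = 0
  rw [← he]
  constructor
  · intro hx
    have hxH := hZ.1 hx
    exact ⟨hxH, by rw [hσ x hxH]; exact (hφ ⟨x, hxH⟩).mp hx⟩
  · rintro ⟨hxH, hx⟩
    rw [hσ x hxH] at hx
    exact (hφ ⟨x, hxH⟩).mpr hx

theorem IsTopoplane.dense_compl {k : ℕ} {H : Set (Fin (k + 1) → ℝ)} (hH : IsTopoplane H) :
    Dense Hᶜ := by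
  obtain ⟨e, he⟩ := hH.exists_homeomorph
  have h1 : Hᶜ = (fun x => (e x).1) ⁻¹' {0}ᶜ := by
    ext x
    simp [he]
  rw [h1]
  exact (dense_compl_singleton (0 : ℝ)).preimage (isOpenMap_fst.comp e.isOpenMap)

theorem IsTopoplane.isClosed {k : ℕ} {H : Set (Fin (k + 1) → ℝ)} (hH : IsTopoplane H) :
    IsClosed H := by
  obtain ⟨e, he⟩ := hH.exists_homeomorph
  have h1 : H = (fun x => (e x).1) ⁻¹' {0} := by
    ext x
    simp [he]
  rw [h1]
  exact isClosed_singleton.preimage (by fun_prop)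

end Charts

section Separation

variable {X : Type*} [TopologicalSpace X] {A B : Set X}

theorem exists_mem_pos_of_closure_component {f : X → ℝ} (hf : Continuous f)
    (hA : ∀ x, x ∈ A ↔ f x = 0) (hB : Dense Bᶜ) (hpos : ∃ x, 0 < f x)
    (h : ∀ x ∉ A ∪ B, (closure (connectedComponentIn (A ∪ B)ᶜ x) ∩ (B \ A)).Nonempty) :
    ∃ x ∈ B, 0 < f x := by
  obtain ⟨x, hx, hxB⟩ := hB.inter_open_nonempty _ (isOpen_lt continuous_const hf) hpos
  have hxA : x ∉ A := fun hxA => hx.ne' ((hA x).mp hxA)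
  have hxAB : x ∈ (A ∪ B)ᶜ := fun h' => h'.elim hxA hxB
  obtain ⟨y, hy, hyB, hyA⟩ := h x hxAB
  have hC : connectedComponentIn (A ∪ B)ᶜ x ⊆ {z | 0 ≤ f z} := by
    rcases isPreconnected_connectedComponentIn.forall_pos_or_forall_neg hf.continuousOn
      (fun z hz hz0 => connectedComponentIn_subset (A ∪ B)ᶜ x hz (Or.inl ((hA z).mpr hz0))) with h1 | h1
    · exact fun z hz => (h1 z hz).le
    · exact absurd (h1 x (mem_connectedComponentIn hxAB)) hx.not_gt
  have hy0 : 0 ≤ f y := closure_minimal hC (isClosed_le continuous_const hf) hy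
  exact ⟨y, hyB, hy0.lt_of_ne fun h0 => hyA ((hA y).mpr h0.symm)⟩

theorem nonempty_closure_component_inter {W : Set X} {x y : X} {γ : ℝ → X} (hγ : Continuous γ)
    (h0 : γ 0 = x) (h1 : γ 1 = y) (hW : ∀ t ∈ Ico (0 : ℝ) 1, γ t ∈ W) :
    y ∈ closure (connectedComponentIn W x) := by
  have hsub : γ '' Ico 0 1 ⊆ connectedComponentIn W x :=
    (isPreconnected_Ico.image _ hγ.continuousOn).subset_connectedComponentIn
      ⟨0, by norm_num, h0⟩ (by rintro _ ⟨t, ht, rfl⟩; exact hW t ht)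
  refine closure_mono hsub (image_closure_subset_closure_image hγ ⟨1, ?_, h1⟩)
  rw [closure_Ico (by norm_num)]
  norm_num

end Separation

section Main

theorem closure_component_inter_nonempty {n : ℕ} {A B : Set (Fin n → ℝ)}
    (e : (Fin n → ℝ) ≃ₜ (Fin n → ℝ)) {i j : Fin n} (hij : i ≠ j) (hA : ∀ x, x ∈ A ↔ e x i = 0)
    (hB : ∀ x, x ∈ B ↔ e x j = 0) {x : Fin n → ℝ} (hx : x ∉ A ∪ B) :
    (closure (connectedComponentIn (A ∪ B)ᶜ x) ∩ (A \ B)).Nonempty := by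
  simp only [mem_union, hA, hB, not_or] at hx
  let γ : ℝ → (Fin n → ℝ) := fun t => e.symm (Function.update (e x) i ((1 - t) * e x i))
  have hγi : ∀ t, e (γ t) i = (1 - t) * e x i := fun t => by simp [γ]
  have hγj : ∀ t, e (γ t) j = e x j := fun t => by simp [γ, hij.symm]
  refine ⟨γ 1, nonempty_closure_component_inter (γ := γ) ?_ ?_ rfl fun t ht => ?_, ?_, ?_⟩
  · exact e.symm.continuous.comp (continuous_const.update i (by fun_prop))
  · simp [γ]
  · simp only [mem_compl_iff, mem_union, hA, hB, hγi, hγj, not_or, mul_eq_zero]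
    exact ⟨⟨by linarith [ht.2], hx.1⟩, hx.2⟩
  · rw [hA, hγi, sub_self, zero_mul]
  · rw [hB, hγj]
    exact hx.2

theorem Crosses.closure_component_inter_nonempty {n : ℕ} (hn : 1 ≤ n) {H₁ H₂ : Set (Fin n → ℝ)}
    (h : Crosses H₁ H₂) {x : Fin n → ℝ} (hx : x ∉ H₁ ∪ H₂) :
    (closure (connectedComponentIn (H₁ ∪ H₂)ᶜ x) ∩ (H₁ \ H₂)).Nonempty ∧
      (closure (connectedComponentIn (H₁ ∪ H₂)ᶜ x) ∩ (H₂ \ H₁)).Nonempty := by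
  obtain ⟨e, h₁, h₂⟩ := h
  have hn' : 1 < n := by
    by_contra hn'
    refine hx (Or.inr ?_)
    rw [← e.injective.mem_set_image, h₂]
    exact fun h => absurd h hn'
  have hA : ∀ y, y ∈ H₁ ↔ e y ⟨0, hn⟩ = 0 := fun y => by
    rw [← e.injective.mem_set_image, h₁, coordHyp_of_lt hn]
    rfl
  have hB : ∀ y, y ∈ H₂ ↔ e y ⟨1, hn'⟩ = 0 := fun y => by
    rw [← e.injective.mem_set_image, h₂, coordHyp_of_lt hn']
    rfl
  refine ⟨_root_.closure_component_inter_nonempty e (by simp) hA hB hx, ?_⟩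
  rw [union_comm] at hx ⊢
  exact _root_.closure_component_inter_nonempty e (by simp) hB hA hx

theorem IsArrangement.isRelTopoplane {n : ℕ} {𝓗 : Set (Set (Fin n → ℝ))} (h𝓗 : IsArrangement 𝓗)
    {H₁ H₂ : Set (Fin n → ℝ)} (h₁ : H₁ ∈ 𝓗) (h₂ : H₂ ∈ 𝓗) (hne : (H₁ ∩ H₂).Nonempty)
    (hsub : (H₁ \ H₂).Nonempty) : IsRelTopoplane H₁ (H₁ ∩ H₂) := by
  obtain h | h | h := h𝓗.2.2 H₂ h₂ H₁
    ⟨⟨{H₁}, singleton_subset_iff.mpr h₁, (sInter_singleton _).symm⟩, hne.mono inter_subset_left⟩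
  · exact absurd h (sdiff_nonempty.mp hsub)
  · rw [inter_comm, h] at hne
    exact absurd hne not_nonempty_empty
  · rwa [inter_comm]

theorem IsArrangement.crosses {n : ℕ} (hn : 1 ≤ n) {𝓗 : Set (Set (Fin n → ℝ))}
    (h𝓗 : IsArrangement 𝓗) {H₁ H₂ : Set (Fin n → ℝ)} (h₁ : H₁ ∈ 𝓗) (h₂ : H₂ ∈ 𝓗)
    (hne : (H₁ ∩ H₂).Nonempty)
    (h : ∀ x ∉ H₁ ∪ H₂,
      (closure (connectedComponentIn (H₁ ∪ H₂)ᶜ x) ∩ (H₁ \ H₂)).Nonempty ∧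
      (closure (connectedComponentIn (H₁ ∪ H₂)ᶜ x) ∩ (H₂ \ H₁)).Nonempty) :
    Crosses H₁ H₂ := by
  obtain ⟨k, rfl⟩ := Nat.exists_eq_add_of_le' hn
  have t₁ := h𝓗.2.1 H₁ h₁
  have t₂ := h𝓗.2.1 H₂ h₂
  obtain ⟨x, hx⟩ : (H₁ᶜ ∩ H₂ᶜ).Nonempty :=
    (t₁.dense_compl.inter_of_isOpen_left t₂.dense_compl t₁.isClosed.isOpen_compl).nonempty
  obtain ⟨hx₁, hx₂⟩ := h x fun hx' => hx'.elim hx.1 hx.2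
  obtain ⟨m, hk, c₁, hc₁, hc₁'⟩ := t₁.exists_chart
    (h𝓗.isRelTopoplane h₁ h₂ hne (hx₁.mono inter_subset_right))
  obtain ⟨m', hk', c₂, hc₂, hc₂'⟩ := t₂.exists_chart
    (h𝓗.isRelTopoplane h₂ h₁ (by rwa [inter_comm]) (hx₂.mono inter_subset_right))
  obtain rfl : m' = m := by omega
  subst hk
  let e₁ := c₁.trans (prodComplexHomeomorph (Fin m' → ℝ))
  let e₂ := c₂.trans (prodComplexHomeomorphSwap (Fin m' → ℝ))
  have him : ∀ x, x ∈ H₁ ↔ (e₁ x).2.im = 0 := hc₁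
  have hre : ∀ x, x ∈ H₂ ↔ (e₂ x).2.re = 0 := hc₂
  have he₁ : ∀ x, x ∈ H₁ ∩ H₂ ↔ (e₁ x).2 = 0 := fun x => by
    rw [hc₁', Complex.ext_iff, and_comm]
    rfl
  have he₂ : ∀ x, x ∈ H₁ ∩ H₂ ↔ (e₂ x).2 = 0 := fun x => by
    rw [inter_comm, hc₂', Complex.ext_iff]
    rfl
  have hu : ∀ x ∉ H₂ ∪ H₁,
      (closure (connectedComponentIn (H₂ ∪ H₁)ᶜ x) ∩ (H₁ \ H₂)).Nonempty := by
    rw [union_comm]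
    exact fun x hx => (h x hx).1
  have hw : ∀ (e : (Fin (m' + 1 + 1) → ℝ) ≃ₜ (Fin m' → ℝ) × ℂ) (z : ℂ), ∃ x, (e x).2 = z :=
    fun e z => ⟨e.symm (0, z), by rw [e.apply_symm_apply]⟩
  have hI : ∀ ε : ℝ, ε ≠ 0 → ∃ x, (e₂ x).2.re = 0 ∧ 0 < ε * (e₁ x).2.im := fun ε hε => by
    obtain ⟨y, hy⟩ := hw e₁ ⟨0, ε⟩
    obtain ⟨x, hx, hx'⟩ := exists_mem_pos_of_closure_component (f := fun x => ε * (e₁ x).2.im)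
      (A := H₁) (B := H₂) (by fun_prop) (fun x => by rw [him, mul_eq_zero, or_iff_right hε])
      t₂.dense_compl ⟨y, by simpa only [hy] using mul_self_pos.mpr hε⟩ fun x hx => (h x hx).2
    exact ⟨x, (hre x).mp hx, hx'⟩
  have hR : ∀ ε : ℝ, ε ≠ 0 → ∃ x, (e₁ x).2.im = 0 ∧ 0 < ε * (e₂ x).2.re := fun ε hε => by
    obtain ⟨y, hy⟩ := hw e₂ ⟨ε, 0⟩
    obtain ⟨x, hx, hx'⟩ := exists_mem_pos_of_closure_component (f := fun x => ε * (e₂ x).2.re)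
      (A := H₂) (B := H₁) (by fun_prop) (fun x => by rw [hre, mul_eq_zero, or_iff_right hε])
      t₁.dense_compl ⟨y, by simpa only [hy] using mul_self_pos.mpr hε⟩ hu
    exact ⟨x, (him x).mp hx, hx'⟩
  obtain ⟨N, hN⟩ := exists_homeomorph_forall_im_re e₁ e₂
    (fun x => by rw [← he₁, ← him, ← hre]; rfl) (fun x => by rw [← he₂, ← him, ← hre]; rfl)
    ⟨by simpa using hI 1 one_ne_zero, by simpa using hI (-1) (by norm_num)⟩
    ⟨by simpa using hR 1 one_ne_zero, by simpa using hR (-1) (by norm_num)⟩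
  let E : (Fin (m' + 1 + 1) → ℝ) ≃ₜ (Fin m' → ℝ) × ℂ :=
    ((splitFirst (m' + 1)).trans ((Homeomorph.refl ℝ).prodCongr (splitFirst m'))).trans
      (prodComplexHomeomorph (Fin m' → ℝ))
  have hE1 : ∀ x, (E x).2.im = x 0 := fun x => rfl
  have hE2 : ∀ x, (E x).2.re = x 1 := fun x => rfl
  refine ⟨N.trans E.symm, ?_, ?_⟩
  · rw [Homeomorph.image_eq_preimage_symm, coordHyp_of_lt (Nat.succ_pos _)]
    ext x
    change N.symm (E x) ∈ H₁ ↔ x 0 = 0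
    rw [him, ← (hN _).1, N.apply_symm_apply, hE1]
  · rw [Homeomorph.image_eq_preimage_symm, coordHyp_of_lt (Nat.succ_lt_succ (Nat.succ_pos _))]
    ext x
    change N.symm (E x) ∈ H₂ ↔ x 1 = 0
    rw [hre, ← (hN _).2, N.apply_symm_apply, hE2]

end Main

/-- an arrangement `𝓗` of topoplanes in `ℝⁿ` is affine if and only if for
every pair of distinct intersecting topoplanes `H₁, H₂ ∈ 𝓗`, every connected component
of `ℝⁿ ∖ (H₁ ∪ H₂)` has closure meeting both `H₁ ∖ H₂` and `H₂ ∖ H₁`. -/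
theorem statement3 {n : ℕ} (hn : 1 ≤ n) (𝓗 : Set (Set (Fin n → ℝ)))
    (h𝓗 : IsArrangement 𝓗) :
    PairwiseAffine 𝓗 ↔
      ∀ H₁ ∈ 𝓗, ∀ H₂ ∈ 𝓗, H₁ ≠ H₂ → (H₁ ∩ H₂).Nonempty →
        ∀ x ∉ H₁ ∪ H₂,
          (closure (connectedComponentIn (H₁ ∪ H₂)ᶜ x) ∩ (H₁ \ H₂)).Nonempty ∧
          (closure (connectedComponentIn (H₁ ∪ H₂)ᶜ x) ∩ (H₂ \ H₁)).Nonempty := by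
  constructor
  · rintro h H₁ h₁ H₂ h₂ hne hint x hx
    exact ((h H₁ h₁ H₂ h₂ hne).resolve_left hint.ne_empty).closure_component_inter_nonempty hn hx
  · intro h H₁ h₁ H₂ h₂ hne
    rcases eq_empty_or_nonempty (H₁ ∩ H₂) with hint | hint
    · exact Or.inl hint
    · exact Or.inr (h𝓗.crosses hn h₁ h₂ hint (h H₁ h₁ H₂ h₂ hne hint))
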